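/- Let A be a finite-dimensional Z-graded self-injective K-algebra with triangular decomposition (A⁻,T,A⁺), T semisimple. Then for each simple graded T-module λ, the projective cover P(λ) of L(λ) in the graded module category is a highest weight object: there is a unique λ^h such that [P(λ) : L(λ^h)] = 1 and every composition factor L(μ) of P(λ) satisfies deg μ ≤ deg λ^h, with equality only for μ = λ^h; moreover Δ(λ^h) appears at the bottom of any standard filtration of P(λ), and λ ↦ λ^h is a permutation of the simple graded T-modules. -/

import Mathlib

open scoped TensorProduct

universe u

namespace TriangularPaper

variable (K A : Type u) [Field K] [Ring A] [Algebra K A]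

/-- The multiplication map `M ⊗ N → A` for two `K`-subspaces of `A`. -/
noncomputable def mulMap (M N : Submodule K A) : (↥M ⊗[K] ↥N) →ₗ[K] A :=
  (LinearMap.mul' K A).comp (TensorProduct.map M.subtype N.subtype)

/-- The triple multiplication map `(P ⊗ Q) ⊗ R → A`. -/
noncomputable def triMulMap (P Q R : Submodule K A) :
    ((↥P ⊗[K] ↥Q) ⊗[K] ↥R) →ₗ[K] A :=
  (LinearMap.mul' K A).comp (TensorProduct.map (mulMap K A P Q) R.subtype)

/-- A triangular decomposition `(A⁻, T, A⁺)` of the finite-dimensional graded algebra `A`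
with internal grading `𝒜`, in the sense of Holmes–Nakano. -/
structure TriangularDecomposition (𝒜 : ℤ → Submodule K A)
    (Am T Ap : Subalgebra K A) : Prop where
  /-- `𝒜` is a grading of `A` -/
  internal : DirectSum.IsInternal 𝒜
  one_mem : (1 : A) ∈ 𝒜 0
  mul_mem : ∀ i j : ℤ, ∀ a b : A, a ∈ 𝒜 i → b ∈ 𝒜 j → a * b ∈ 𝒜 (i + j)
  /-- multiplication `A⁻ ⊗ T ⊗ A⁺ → A` is a linear isomorphism -/
  mul_bij : Function.Bijective (triMulMap K A Am.toSubmodule T.toSubmodule Ap.toSubmodule)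
  /-- `T` is concentrated in degree `0` -/
  T_deg0 : T.toSubmodule ≤ 𝒜 0
  /-- `A⁻` is supported in nonpositive degrees -/
  neg_supp : Am.toSubmodule ≤ ⨆ n : ℕ, 𝒜 (-(n : ℤ))
  /-- `A⁺` is supported in nonnegative degrees -/
  pos_supp : Ap.toSubmodule ≤ ⨆ n : ℕ, 𝒜 (n : ℤ)
  /-- `A⁻` is a graded subalgebra -/
  neg_graded : Am.toSubmodule = ⨆ i : ℤ, Am.toSubmodule ⊓ 𝒜 i
  /-- `A⁺` is a graded subalgebra -/
  pos_graded : Ap.toSubmodule = ⨆ i : ℤ, Ap.toSubmodule ⊓ 𝒜 i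
  /-- `A⁻₀ = K` -/
  neg_deg0 : Am.toSubmodule ⊓ 𝒜 0 = Submodule.span K {(1 : A)}
  /-- `A⁺₀ = K` -/
  pos_deg0 : Ap.toSubmodule ⊓ 𝒜 0 = Submodule.span K {(1 : A)}
  /-- `A⁺T = TA⁺` as subspaces of `A` -/
  comm_pos : Ap.toSubmodule * T.toSubmodule = T.toSubmodule * Ap.toSubmodule
  /-- `A⁻T = TA⁻` as subspaces of `A` -/
  comm_neg : Am.toSubmodule * T.toSubmodule = T.toSubmodule * Am.toSubmodule
  /-- `T` is a split `K`-algebra -/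
  T_split : ∀ (V : Type u) [AddCommGroup V] [Module ↥T V], IsSimpleModule ↥T V →
    ∀ f : V →ₗ[↥T] V, ∃ c : K, ∀ v, f v = algebraMap K ↥T c • v

/-- The negative Borel subalgebra `B⁻ = A⁻T` (as a subspace). -/
noncomputable def Bneg (Am T : Subalgebra K A) : Submodule K A :=
  Am.toSubmodule * T.toSubmodule

/-- The positive Borel subalgebra `B⁺ = A⁺T` (as a subspace). -/
noncomputable def Bpos (T Ap : Subalgebra K A) : Submodule K A :=
  Ap.toSubmodule * T.toSubmodule

/-- The augmentation ideal `J⁺` of the positive Borel subalgebra. -/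
noncomputable def Jpos (𝒜 : ℤ → Submodule K A) (T Ap : Subalgebra K A) : Submodule K A :=
  ⨆ (i : ℤ) (_ : 0 < i), Bpos K A T Ap ⊓ 𝒜 i

/-- The augmentation ideal `J⁻` of the negative Borel subalgebra. -/
noncomputable def Jneg (𝒜 : ℤ → Submodule K A) (Am T : Subalgebra K A) : Submodule K A :=
  ⨆ (i : ℤ) (_ : i < 0), Bneg K A Am T ⊓ 𝒜 i

/-- `(D, ι)` realizes the proper standard module `Δ̄(M) = A ⊗_{B⁺} Inf_T^{B⁺} M`,
expressed through its universal property `Hom_A(Δ̄(M), N) ≅ Hom_{B⁺}(Inf M, Res N)`. -/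
def IsProperStandardFor (𝒜 : ℤ → Submodule K A) (T Ap : Subalgebra K A)
    (M : Type u) [AddCommGroup M] [Module ↥T M]
    (D : Type u) [AddCommGroup D] [Module A D] (ι : M →+ D) : Prop :=
  (∀ (t : ↥T) (m : M), ι (t • m) = (t : A) • ι m) ∧
  (∀ a ∈ Jpos K A 𝒜 T Ap, ∀ m : M, a • ι m = 0) ∧
  ∀ (N : Type u) [AddCommGroup N] [Module A N] (f : M →+ N),
    (∀ (t : ↥T) (m : M), f (t • m) = (t : A) • f m) →
    (∀ a ∈ Jpos K A 𝒜 T Ap, ∀ m : M, a • f m = 0) →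
    ∃! F : D →ₗ[A] N, ∀ m, F (ι m) = f m

/-- `(D, p)` realizes the proper costandard module `∇̄(M)`, expressed through its
couniversal property `Hom_A(N, ∇̄(M)) ≅ Hom_{B⁻}(Res N, Inf M)`. -/
def IsProperCostandardFor (𝒜 : ℤ → Submodule K A) (Am T : Subalgebra K A)
    (M : Type u) [AddCommGroup M] [Module ↥T M]
    (D : Type u) [AddCommGroup D] [Module A D] (p : D →+ M) : Prop :=
  (∀ (t : ↥T) (x : D), p ((t : A) • x) = t • p x) ∧
  (∀ a ∈ Jneg K A 𝒜 Am T, ∀ x : D, p (a • x) = 0) ∧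
  ∀ (N : Type u) [AddCommGroup N] [Module A N] (f : N →+ M),
    (∀ (t : ↥T) (x : N), f ((t : A) • x) = t • f x) →
    (∀ a ∈ Jneg K A 𝒜 Am T, ∀ x : N, f (a • x) = 0) →
    ∃! F : N →ₗ[A] D, ∀ x, p (F x) = f x

/-- A compatible grading on an `A`-module `D`, making it an object of `𝒢(A)`. -/
def IsModuleGrading (𝒜 : ℤ → Submodule K A) {D : Type u} [AddCommGroup D] [Module A D]
    [Module K D] [IsScalarTower K A D] (ℳ : ℤ → Submodule K D) : Prop :=
  DirectSum.IsInternal ℳ ∧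
    ∀ (i j : ℤ) (a : A) (x : D), a ∈ 𝒜 i → x ∈ ℳ j → a • x ∈ ℳ (i + j)

end TriangularPaper

namespace TriangularPaper

variable (K A : Type u) [Field K] [Ring A] [Algebra K A]

/-- Two `R`-modules have the same class in the Grothendieck group `K₀`:
they admit finite filtrations with isomorphic factors up to permutation. -/
def MatchingFactors (R : Type u) [Ring R] (X Y : Type u) [AddCommGroup X] [Module R X]
    [AddCommGroup Y] [Module R Y] : Prop :=
  ∃ (n : ℕ) (F : Fin (n + 1) → Submodule R X) (G : Fin (n + 1) → Submodule R Y)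
    (σ : Equiv.Perm (Fin n)),
    Monotone F ∧ Monotone G ∧ F 0 = ⊥ ∧ F (Fin.last n) = ⊤ ∧ G 0 = ⊥ ∧ G (Fin.last n) = ⊤ ∧
    ∀ k : Fin n, Nonempty
      ((↥(F k.succ) ⧸ Submodule.comap (F k.succ).subtype (F k.castSucc)) ≃ₗ[R]
       (↥(G (σ k).succ) ⧸ Submodule.comap (G (σ k).succ).subtype (G (σ k).castSucc)))

/-- The induced degree-`i` piece on the subquotient `Q/P` of a graded module. -/
noncomputable def factorPiece {M : Type u} [AddCommGroup M] [Module A M] [Module K M]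
    [IsScalarTower K A M] (ℳ : ℤ → Submodule K M) (P Q : Submodule A M) (i : ℤ) :
    Set (↥Q ⧸ Submodule.comap Q.subtype P) :=
  (Submodule.comap Q.subtype P).mkQ '' {x : ↥Q | (x : M) ∈ ℳ i}

/-- Two graded `A`-modules have the same class in the Grothendieck group `K₀(𝒢(A))`:
they admit finite filtrations by graded submodules whose factors are isomorphic as
graded `A`-modules, up to permutation. -/
def GradedMatchingFactors {M N : Type u} [AddCommGroup M] [Module A M] [Module K M]
    [IsScalarTower K A M] [AddCommGroup N] [Module A N] [Module K N] [IsScalarTower K A N]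
    (ℳ : ℤ → Submodule K M) (𝒩 : ℤ → Submodule K N) : Prop :=
  ∃ (n : ℕ) (F : Fin (n + 1) → Submodule A M) (G : Fin (n + 1) → Submodule A N)
    (σ : Equiv.Perm (Fin n)),
    Monotone F ∧ Monotone G ∧ F 0 = ⊥ ∧ F (Fin.last n) = ⊤ ∧ G 0 = ⊥ ∧ G (Fin.last n) = ⊤ ∧
    ∀ k : Fin n, ∃ e :
        (↥(F k.succ) ⧸ Submodule.comap (F k.succ).subtype (F k.castSucc)) ≃ₗ[A]
        (↥(G (σ k).succ) ⧸ Submodule.comap (G (σ k).succ).subtype (G (σ k).castSucc)),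
      ∀ i : ℤ, e '' factorPiece K A ℳ (F k.castSucc) (F k.succ) i =
        factorPiece K A 𝒩 (G (σ k).castSucc) (G (σ k).succ) i

end TriangularPaper

namespace TriangularPaper

variable (K A : Type u) [Field K] [Ring A] [Algebra K A]

/-- A submodule of a graded module is *graded* if it is generated by its homogeneous
elements. -/
def IsGradedSubmodule' {S : Type u} [AddCommGroup S] [Module A S] [Module K S]
    [IsScalarTower K A S] (𝒮 : ℤ → Submodule K S) (N : Submodule A S) : Prop :=
  (N : Set S) ⊆ ↑(Submodule.span A (⋃ i : ℤ, (N : Set S) ∩ ↑(𝒮 i)))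

/-- `(S, 𝒮)` is the simple graded `A`-module `L(λ)` attached to the simple graded
`T`-module `λ = (Ml, d)`: it is graded-simple, supported in degrees `≤ d`, with
top component isomorphic to `λ` as a `T`-module. -/
def IsLModule (𝒜 : ℤ → Submodule K A) (T : Subalgebra K A) (d : ℤ)
    (Ml : Type u) [AddCommGroup Ml] [Module ↥T Ml]
    (S : Type u) [AddCommGroup S] [Module A S] [Module K S] [IsScalarTower K A S]
    (𝒮 : ℤ → Submodule K S) : Prop :=
  IsModuleGrading K A 𝒜 𝒮 ∧ Nontrivial S ∧
  (∀ N : Submodule A S, IsGradedSubmodule' K A 𝒮 N → N = ⊥ ∨ N = ⊤) ∧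
  (∀ i : ℤ, d < i → 𝒮 i = ⊥) ∧
  ∃ ι : Ml →+ S, Function.Injective ι ∧ Set.range ι = (𝒮 d : Set S) ∧
    ∀ (t : ↥T) (m : Ml), ι (t • m) = (t : A) • ι m

/-- `(P, 𝒬, φ)` is a projective cover of `(S, 𝒮)` in the graded module category. -/
def IsGradedProjectiveCover (𝒜 : ℤ → Submodule K A)
    (S : Type u) [AddCommGroup S] [Module A S] [Module K S] [IsScalarTower K A S]
    (𝒮 : ℤ → Submodule K S)
    (P : Type u) [AddCommGroup P] [Module A P] [Module K P] [IsScalarTower K A P]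
    (𝒬 : ℤ → Submodule K P) (φ : P →ₗ[A] S) : Prop :=
  IsModuleGrading K A 𝒜 𝒬 ∧ Module.Projective A P ∧ Module.Finite A P ∧
  Function.Surjective φ ∧ (∀ i : ℤ, φ '' (𝒬 i : Set P) ⊆ (𝒮 i : Set S)) ∧
  ∀ N : Submodule A P, N ⊔ LinearMap.ker φ = ⊤ → N = ⊤

/-- A graded subquotient, with pieces `pieces : ℤ → Set Q`, is a copy of the simple
graded module `L(μ)` for `μ = (Mh, d')`: its pieces vanish above degree `d'` and its
degree-`d'` piece is a copy of `Mh` as a `T`-module. -/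
def IsLFactor (T : Subalgebra K A) {Q : Type u} [AddCommGroup Q] [Module A Q]
    (pieces : ℤ → Set Q) (Mh : Type u) [AddCommGroup Mh] [Module ↥T Mh]
    (d' : ℤ) : Prop :=
  (∀ i : ℤ, d' < i → pieces i ⊆ {0}) ∧
  ∃ ιh : Mh →+ Q, Function.Injective ιh ∧ Set.range ιh = pieces d' ∧
    ∀ (t : ↥T) (m : Mh), ιh (t • m) = (t : A) • ιh m

/-- A filtration of a graded module by graded submodules with graded-simple factors,
i.e. a composition series in `𝒢(A)`. -/
def IsGradedCompSeries (𝒜 : ℤ → Submodule K A) {M : Type u} [AddCommGroup M]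
    [Module A M] [Module K M] [IsScalarTower K A M] (ℳ : ℤ → Submodule K M)
    (n : ℕ) (F : Fin (n + 1) → Submodule A M) : Prop :=
  Monotone F ∧ F 0 = ⊥ ∧ F (Fin.last n) = ⊤ ∧
  (∀ k, IsGradedSubmodule' K A ℳ (F k)) ∧
  ∀ k : Fin n,
    Nontrivial (↥(F k.succ) ⧸ Submodule.comap (F k.succ).subtype (F k.castSucc)) ∧
    ∀ N : Submodule A (↥(F k.succ) ⧸ Submodule.comap (F k.succ).subtype (F k.castSucc)),
      N ≤ Submodule.span A
        (⋃ i : ℤ, (N : Set _) ∩ factorPiece K A ℳ (F k.castSucc) (F k.succ) i) →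
      N = ⊥ ∨ N = ⊤

/-- The graded module `(P, 𝒬)` has highest weight `λ^h = (Mh, d')`: in any graded
composition series of `P`, all composition factors `L(μ)` satisfy `deg μ ≤ d'`,
exactly one factor has a nonzero piece in degree `d'`, and that factor is a copy of
`L(Mh, d')` (so `[P : L(Mh,d')] = 1`, with `deg μ = d'` only for `μ = λ^h`). -/
def IsHighestWeightOf (𝒜 : ℤ → Submodule K A) (T : Subalgebra K A)
    (P : Type u) [AddCommGroup P] [Module A P] [Module K P] [IsScalarTower K A P]
    (𝒬 : ℤ → Submodule K P) (Mh : Type u) [AddCommGroup Mh] [Module ↥T Mh]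
    (d' : ℤ) : Prop :=
  ∀ (n : ℕ) (F : Fin (n + 1) → Submodule A P), IsGradedCompSeries K A 𝒜 𝒬 n F →
    (∀ (k : Fin n) (i : ℤ), d' < i →
        factorPiece K A 𝒬 (F k.castSucc) (F k.succ) i ⊆ {0}) ∧
    (∃! k : Fin n, ¬ factorPiece K A 𝒬 (F k.castSucc) (F k.succ) d' ⊆ {0}) ∧
    ∀ k : Fin n, ¬ factorPiece K A 𝒬 (F k.castSucc) (F k.succ) d' ⊆ {0} →
      IsLFactor K A T (factorPiece K A 𝒬 (F k.castSucc) (F k.succ)) Mh d'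

/-- A filtration exhibiting a standard filtration of a graded module. -/
def IsStandardFiltration (𝒜 : ℤ → Submodule K A) (T Ap : Subalgebra K A)
    {M : Type u} [AddCommGroup M] [Module A M] [Module K M] [IsScalarTower K A M]
    (ℳ : ℤ → Submodule K M) (n : ℕ) (F : Fin (n + 1) → Submodule A M) : Prop :=
  Monotone F ∧ F 0 = ⊥ ∧ F (Fin.last n) = ⊤ ∧
  (∀ k, IsGradedSubmodule' K A ℳ (F k)) ∧
  ∀ k : Fin n, ∃ (d : ℤ) (Ml : Type u) (_ : AddCommGroup Ml) (_ : Module ↥T Ml),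
    IsSimpleModule ↥T Ml ∧
    ∃ ι : Ml →+ (↥(F k.succ) ⧸ Submodule.comap (F k.succ).subtype (F k.castSucc)),
      IsProperStandardFor K A 𝒜 T Ap Ml _ ι ∧
      ∀ m : Ml, ι m ∈ factorPiece K A ℳ (F k.castSucc) (F k.succ) d

end TriangularPaper

namespace TriangularPaper

section

variable {K A : Type u} [Field K] [Ring A] [Algebra K A]

section Projections

variable {M : Type u} [AddCommGroup M] [Module K M] {ℳ : ℤ → Submodule K M}

/-- Projection onto the degree-`i` component of a graded space. -/
noncomputable def gproj (h : DirectSum.IsInternal ℳ) (i : ℤ) : M →ₗ[K] M :=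
  (ℳ i).subtype ∘ₗ DirectSum.component K ℤ (fun j => ℳ j) i ∘ₗ
    (LinearEquiv.ofBijective (DirectSum.coeLinearMap ℳ) h).symm.toLinearMap

theorem gproj_mem (h : DirectSum.IsInternal ℳ) (i : ℤ) (x : M) : gproj h i x ∈ ℳ i :=
  Subtype.coe_prop _

theorem gproj_coe_directSum (h : DirectSum.IsInternal ℳ) (i : ℤ) (y : DirectSum ℤ fun j => ℳ j) :
    gproj h i (DirectSum.coeLinearMap ℳ y) = y i := by
  have : (LinearEquiv.ofBijective (DirectSum.coeLinearMap ℳ) h).symm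
      (DirectSum.coeLinearMap ℳ y) = y :=
    (LinearEquiv.ofBijective (DirectSum.coeLinearMap ℳ) h).symm_apply_apply y
  simp only [gproj, LinearMap.comp_apply, LinearEquiv.coe_coe, this]
  rfl

theorem gproj_of_mem (h : DirectSum.IsInternal ℳ) {i : ℤ} {x : M} (hx : x ∈ ℳ i) :
    gproj h i x = x := by
  have := gproj_coe_directSum h i (DirectSum.lof K ℤ (fun j => ℳ j) i ⟨x, hx⟩)
  rw [DirectSum.coeLinearMap_lof] at this
  simpa [DirectSum.lof_apply] using this

theorem gproj_of_ne (h : DirectSum.IsInternal ℳ) {i j : ℤ} (hij : i ≠ j) {x : M}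
    (hx : x ∈ ℳ i) : gproj h j x = 0 := by
  have := gproj_coe_directSum h j (DirectSum.lof K ℤ (fun j => ℳ j) i ⟨x, hx⟩)
  rw [DirectSum.coeLinearMap_lof] at this
  simpa [DirectSum.lof_eq_of, DirectSum.of_eq_of_ne _ _ _ hij.symm] using this

theorem homogeneous_induction (h : DirectSum.IsInternal ℳ) {p : M → Prop} (x : M)
    (zero : p 0) (hom : ∀ i, ∀ y ∈ ℳ i, p y) (add : ∀ y z, p y → p z → p (y + z)) : p x := by
  have hx : x ∈ ⨆ i, ℳ i := by rw [h.submodule_iSup_eq_top]; trivial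
  exact Submodule.iSup_induction ℳ (motive := p) hx hom zero add

theorem gproj_ext (h : DirectSum.IsInternal ℳ) {x y : M}
    (hxy : ∀ i, gproj h i x = gproj h i y) : x = y := by
  obtain ⟨a, rfl⟩ := h.surjective x
  obtain ⟨b, rfl⟩ := h.surjective y
  congr 1
  ext i
  have := hxy i
  erw [gproj_coe_directSum, gproj_coe_directSum] at this
  exact this

theorem gproj_finite (h : DirectSum.IsInternal ℳ) (x : M) : {i | gproj h i x ≠ 0}.Finite := by
  induction x using homogeneous_induction h with
  | zero => simp
  | hom i y hy =>
    refine (Set.finite_singleton i).subset fun j hj => ?_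
    by_contra hne
    exact hj (gproj_of_ne h (fun e => hne e.symm) hy)
  | add y z hy hz =>
    refine (hy.union hz).subset fun j hj => ?_
    by_contra hne
    simp only [Set.mem_union, Set.mem_ofPred_eq, not_or, not_not] at hne
    exact hj (by rw [map_add, hne.1, hne.2, add_zero])

theorem eq_sum_gproj (h : DirectSum.IsInternal ℳ) (x : M) :
    x = ∑ i ∈ (gproj_finite h x).toFinset, gproj h i x := by
  refine gproj_ext h fun j => ?_
  rw [map_sum]
  by_cases hj : gproj h j x = 0
  · rw [hj, Finset.sum_eq_zero]
    intro i _
    by_cases hij : i = j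
    · rw [hij, hj, map_zero]
    · exact gproj_of_ne h hij (gproj_mem h i x)
  · rw [Finset.sum_eq_single j]
    · exact (gproj_of_mem h (gproj_mem h j x)).symm
    · intro i _ hij
      exact gproj_of_ne h hij (gproj_mem h i x)
    · intro hn
      simp [hj] at hn

theorem mem_of_gproj_mem (h : DirectSum.IsInternal ℳ) {σ : Type*} [SetLike σ M]
    [AddSubmonoidClass σ M] {N : σ} {x : M} (hx : ∀ i, gproj h i x ∈ N) : x ∈ N := by
  rw [eq_sum_gproj h x]
  exact sum_mem fun i _ => hx i

theorem isInternal_of_projections (p : ℤ → M →ₗ[K] M) (hid : ∀ i, ∀ x ∈ ℳ i, p i x = x)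
    (hne : ∀ i j, i ≠ j → ∀ x ∈ ℳ i, p j x = 0) (hsup : ∀ x, x ∈ ⨆ i, ℳ i) :
    DirectSum.IsInternal ℳ := by
  rw [DirectSum.isInternal_submodule_iff_iSupIndep_and_iSup_eq_top]
  refine ⟨fun i => ?_, Submodule.eq_top_iff'.2 hsup⟩
  rw [Submodule.disjoint_def]
  intro x hx hx'
  have : (⨆ j, ⨆ (_ : j ≠ i), ℳ j) ≤ LinearMap.ker (p i) :=
    iSup₂_le fun j hj y hy => hne j i hj y hy
  rw [← hid i x hx]
  exact this hx'

/-- The elements all of whose components live in degrees at most `n`. -/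
def degLE (h : DirectSum.IsInternal ℳ) (n : ℤ) : Submodule K M where
  carrier := {x | ∀ i, n < i → gproj h i x = 0}
  add_mem' hx hy i hi := by rw [map_add, hx i hi, hy i hi, add_zero]
  zero_mem' i _ := map_zero _
  smul_mem' c x hx i hi := by rw [map_smul, hx i hi, smul_zero]

theorem mem_degLE_of_mem (h : DirectSum.IsInternal ℳ) {n i : ℤ} (hi : i ≤ n) {x : M}
    (hx : x ∈ ℳ i) : x ∈ degLE h n :=
  fun j hj => gproj_of_ne h (by omega) hx

theorem degLE_eq_iSup (h : DirectSum.IsInternal ℳ) (n : ℤ) :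
    degLE h n = ⨆ (i : ℤ) (_ : i ≤ n), ℳ i := by
  refine le_antisymm (fun x hx => ?_) (iSup₂_le fun i hi x hx => mem_degLE_of_mem h hi hx)
  refine mem_of_gproj_mem h fun i => ?_
  by_cases hi : i ≤ n
  · exact Submodule.mem_iSup_of_mem i (Submodule.mem_iSup_of_mem hi (gproj_mem h i x))
  · rw [hx i (by omega)]
    exact zero_mem _

theorem finite_degrees [FiniteDimensional K M] (h : DirectSum.IsInternal ℳ) :
    {i | ℳ i ≠ ⊥}.Finite :=
  WellFoundedGT.finite_ne_bot_of_iSupIndep h.submodule_iSupIndep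

end Projections

section GradedModules

variable {𝒜 : ℤ → Submodule K A} {M : Type u} [AddCommGroup M] [Module A M] [Module K M]
  [IsScalarTower K A M] {ℳ : ℤ → Submodule K M}

theorem gproj_smul (hM : IsModuleGrading K A 𝒜 ℳ) {i : ℤ} {a : A} (ha : a ∈ 𝒜 i)
    (j : ℤ) (x : M) : gproj hM.1 j (a • x) = a • gproj hM.1 (j - i) x := by
  induction x using homogeneous_induction hM.1 with
  | zero => simp
  | hom e y hy =>
    by_cases hj : i + e = j
    · rw [gproj_of_mem hM.1 (hj ▸ hM.2 i e a y ha hy),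
        gproj_of_mem hM.1 (by rwa [← hj, add_sub_cancel_left])]
    · rw [gproj_of_ne hM.1 hj (hM.2 i e a y ha hy), gproj_of_ne hM.1 (by omega) hy, smul_zero]
  | add y z hy hz => rw [smul_add, map_add, hy, hz, map_add, smul_add]

theorem gproj_smul_of_mem (hA : DirectSum.IsInternal 𝒜) (hM : IsModuleGrading K A 𝒜 ℳ)
    {e : ℤ} {x : M} (hx : x ∈ ℳ e) (j : ℤ) (a : A) :
    gproj hM.1 j (a • x) = gproj hA (j - e) a • x := by
  induction a using homogeneous_induction hA with
  | zero => simp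
  | hom i b hb =>
    rw [gproj_smul hM hb]
    by_cases hj : j - i = e
    · rw [hj, gproj_of_mem hM.1 hx, gproj_of_mem hA (by rwa [show j - e = i by omega])]
    · rw [gproj_of_ne hM.1 (by omega) hx, gproj_of_ne hA (by omega) hb, smul_zero, zero_smul]
  | add y z hy hz => rw [add_smul, map_add, hy, hz, map_add, add_smul]

theorem gproj_smul_degLE (hA : DirectSum.IsInternal 𝒜) (hM : IsModuleGrading K A 𝒜 ℳ)
    {n m : ℤ} {a : A} (ha : a ∈ degLE hA n) {x : M} (hx : x ∈ degLE hM.1 m) :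
    gproj hM.1 (n + m) (a • x) = gproj hA n a • gproj hM.1 m x := by
  rw [degLE_eq_iSup] at ha
  refine Submodule.iSup_induction _ (motive := fun a => gproj hM.1 (n + m) (a • x) =
    gproj hA n a • gproj hM.1 m x) ha (fun i b hb => ?_) (by simp) fun y z hy hz => ?_
  · rw [Submodule.mem_iSup] at hb
    by_cases hi : i ≤ n
    · have hb' : b ∈ 𝒜 i := hb _ (fun _ => le_rfl)
      rw [gproj_smul hM hb']
      rcases hi.lt_or_eq with hlt | rfl
      · rw [hx _ (by omega), gproj_of_ne hA hlt.ne hb', smul_zero, zero_smul]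
      · rw [gproj_of_mem hA hb', add_sub_cancel_left]
    · have : b = 0 := by simpa using hb ⊥ (fun h' => absurd h' hi)
      simp [this]
  · rw [add_smul, map_add, hy, hz, map_add, add_smul]

theorem smul_mem_degLE (hA : DirectSum.IsInternal 𝒜) (hM : IsModuleGrading K A 𝒜 ℳ)
    {n m : ℤ} {a : A} (ha : a ∈ degLE hA n) {x : M} (hx : x ∈ degLE hM.1 m) :
    a • x ∈ degLE hM.1 (n + m) := by
  intro i hi
  have h1 : a ∈ degLE hA (i - m) := fun j hj => ha j (by omega)
  have := gproj_smul_degLE hA hM h1 hx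
  rwa [sub_add_cancel, ha (i - m) (by omega), zero_smul] at this

theorem isGradedSubmodule'_iff (hA : DirectSum.IsInternal 𝒜) (hM : IsModuleGrading K A 𝒜 ℳ)
    {N : Submodule A M} :
    IsGradedSubmodule' K A ℳ N ↔ ∀ x ∈ N, ∀ i, gproj hM.1 i x ∈ N := by
  constructor
  · intro h x hx i
    refine Submodule.span_induction (p := fun y _ => ∀ a : A, gproj hM.1 i (a • y) ∈ N)
      (fun y hy a => ?_) (fun a => by simp) (fun y z _ _ hy hz a => ?_)
      (fun b y _ hy a => ?_) (h hx) 1 |> fun h1 => by simpa using h1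
    · obtain ⟨e, hyN, hye⟩ := Set.mem_iUnion.1 hy
      rw [gproj_smul_of_mem hA hM hye]
      exact N.smul_mem _ hyN
    · rw [smul_add, map_add]
      exact add_mem (hy a) (hz a)
    · rw [smul_smul]
      exact hy _
  · intro h x hx
    exact mem_of_gproj_mem hM.1 fun i =>
      Submodule.subset_span (Set.mem_iUnion.2 ⟨i, h x hx i, gproj_mem hM.1 i x⟩)

theorem span_singleton_gproj_mem (hA : DirectSum.IsInternal 𝒜) (hM : IsModuleGrading K A 𝒜 ℳ)
    {e : ℤ} {x : M} (hx : x ∈ ℳ e) (y : M) (hy : y ∈ Submodule.span A {x}) (i : ℤ) :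
    gproj hM.1 i y ∈ Submodule.span A {x} := by
  obtain ⟨a, rfl⟩ := Submodule.mem_span_singleton.1 hy
  rw [gproj_smul_of_mem hA hM hx]
  exact Submodule.smul_mem _ _ (Submodule.mem_span_singleton_self x)

/-- The grading induced on a graded submodule. -/
def subGrading (ℳ : ℤ → Submodule K M) (N : Submodule A M) (i : ℤ) : Submodule K N :=
  (ℳ i).comap (N.subtype.restrictScalars K)

theorem isModuleGrading_sub (hM : IsModuleGrading K A 𝒜 ℳ) {N : Submodule A M}
    (hN : ∀ x ∈ N, ∀ i, gproj hM.1 i x ∈ N) :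
    IsModuleGrading K A 𝒜 (subGrading ℳ N) := by
  refine ⟨isInternal_of_projections (fun i => (gproj hM.1 i).restrict
    (p := N.restrictScalars K) (q := N.restrictScalars K) fun x hx => hN x hx i)
    (fun i x hx => Subtype.ext (gproj_of_mem hM.1 hx))
    (fun i j hij x hx => Subtype.ext (gproj_of_ne hM.1 hij hx)) fun x => ?_,
    fun i j a x ha hx => hM.2 i j a x ha hx⟩
  have hx : x = ∑ i ∈ (gproj_finite hM.1 x).toFinset, ⟨gproj hM.1 i x, hN x x.2 i⟩ := by
    apply Subtype.ext
    rw [AddSubmonoidClass.coe_finsetSum]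
    exact eq_sum_gproj hM.1 (x : M)
  rw [hx]
  exact sum_mem fun i _ => Submodule.mem_iSup_of_mem i (gproj_mem hM.1 i (x : M))

/-- The grading induced on the quotient by a graded submodule. -/
def quotGrading (ℳ : ℤ → Submodule K M) (N : Submodule A M) (i : ℤ) : Submodule K (M ⧸ N) :=
  (ℳ i).map (N.mkQ.restrictScalars K)

theorem mk_mem_quotGrading {N : Submodule A M} {i : ℤ} {x : M} (hx : x ∈ ℳ i) :
    N.mkQ x ∈ quotGrading ℳ N i := ⟨x, hx, rfl⟩

theorem isModuleGrading_quot (hM : IsModuleGrading K A 𝒜 ℳ) {N : Submodule A M}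
    (hN : ∀ x ∈ N, ∀ i, gproj hM.1 i x ∈ N) :
    IsModuleGrading K A 𝒜 (quotGrading ℳ N) := by
  let p : ℤ → (M ⧸ N) →ₗ[K] (M ⧸ N) := fun i =>
    { toFun := Quotient.lift (s := N.quotientRel) (fun x => N.mkQ (gproj hM.1 i x)) (by
        intro x y hxy
        have : x - y ∈ N := (Submodule.quotientRel_def N).1 hxy
        refine (Submodule.Quotient.eq N).2 ?_
        rw [← map_sub]
        exact hN _ this i)
      map_add' := by
        intro x y
        obtain ⟨x, rfl⟩ := N.mkQ_surjective x
        obtain ⟨y, rfl⟩ := N.mkQ_surjective y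
        change N.mkQ (gproj hM.1 i (x + y)) = N.mkQ _ + N.mkQ _
        rw [map_add, map_add]
      map_smul' := by
        intro c x
        obtain ⟨x, rfl⟩ := N.mkQ_surjective x
        change N.mkQ (gproj hM.1 i (c • x)) = c • N.mkQ _
        rw [map_smul]
        rfl }
  refine ⟨isInternal_of_projections p ?_ ?_ ?_, ?_⟩
  · rintro i _ ⟨x, hx, rfl⟩
    exact congrArg N.mkQ (gproj_of_mem hM.1 hx)
  · rintro i j hij _ ⟨x, hx, rfl⟩
    exact (congrArg N.mkQ (gproj_of_ne hM.1 hij hx)).trans (map_zero _)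
  · intro x
    obtain ⟨x, rfl⟩ := N.mkQ_surjective x
    rw [eq_sum_gproj hM.1 x, map_sum]
    exact sum_mem fun i _ => Submodule.mem_iSup_of_mem i (mk_mem_quotGrading (gproj_mem hM.1 i x))
  · rintro i j a _ ha ⟨x, hx, rfl⟩
    exact ⟨a • x, hM.2 i j a x ha hx, map_smul N.mkQ a x⟩

theorem gproj_map {M' : Type u} [AddCommGroup M'] [Module K M'] {ℳ' : ℤ → Submodule K M'}
    (h : DirectSum.IsInternal ℳ) (h' : DirectSum.IsInternal ℳ') {F : Type*} [FunLike F M M']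
    [AddMonoidHomClass F M M'] (φ : F) (hφ : ∀ i, ∀ x ∈ ℳ i, φ x ∈ ℳ' i) (i : ℤ) (x : M) :
    gproj h' i (φ x) = φ (gproj h i x) := by
  induction x using homogeneous_induction h with
  | zero => simp
  | hom e y hy =>
    by_cases he : e = i
    · subst he
      rw [gproj_of_mem h hy, gproj_of_mem h' (hφ _ _ hy)]
    · rw [gproj_of_ne h he hy, gproj_of_ne h' he (hφ _ _ hy), map_zero]
  | add y z hy hz => rw [map_add, map_add, hy, hz, map_add, map_add]

theorem isModuleGrading_shift (hM : IsModuleGrading K A 𝒜 ℳ) (s : ℤ) :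
    IsModuleGrading K A 𝒜 (fun i => ℳ (i + s)) := by
  refine ⟨isInternal_of_projections (fun i => gproj hM.1 (i + s))
    (fun i x hx => gproj_of_mem hM.1 hx)
    (fun i j hij x hx => gproj_of_ne hM.1 (by omega) hx) fun x => ?_, fun i j a x ha hx => ?_⟩
  · rw [eq_sum_gproj hM.1 x]
    refine sum_mem fun i _ => Submodule.mem_iSup_of_mem (i - s) ?_
    rw [sub_add_cancel]
    exact gproj_mem hM.1 i x
  · have := hM.2 i (j + s) a x ha hx
    rwa [← add_assoc] at this

end GradedModules

section Homogenize

variable {𝒜 : ℤ → Submodule K A} {M : Type u} [AddCommGroup M] [Module A M] [Module K M]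
  [IsScalarTower K A M] {ℳ : ℤ → Submodule K M} {M' : Type u} [AddCommGroup M'] [Module A M']
  [Module K M'] [IsScalarTower K A M'] {ℳ' : ℤ → Submodule K M'}

/-- The degree-zero component of a linear map between graded modules. -/
theorem exists_degree_zero_component (hA : DirectSum.IsInternal 𝒜)
    (hM : IsModuleGrading K A 𝒜 ℳ) (hM' : IsModuleGrading K A 𝒜 ℳ') (g : M →ₗ[A] M') :
    ∃ g₀ : M →ₗ[A] M', ∀ i, ∀ x ∈ ℳ i, g₀ x = gproj hM'.1 i (g x) := by
  have key (x : M) (s : Finset ℤ) (hs : (gproj_finite hM.1 x).toFinset ⊆ s) :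
      ∑ i ∈ (gproj_finite hM.1 x).toFinset, gproj hM'.1 i (g (gproj hM.1 i x)) =
        ∑ i ∈ s, gproj hM'.1 i (g (gproj hM.1 i x)) := by
    refine Finset.sum_subset hs fun i _ hi => ?_
    have : gproj hM.1 i x = 0 := by simpa using hi
    rw [this, map_zero, map_zero]
  have hadd (x y : M) :
      ∑ i ∈ (gproj_finite hM.1 (x + y)).toFinset, gproj hM'.1 i (g (gproj hM.1 i (x + y))) =
      ∑ i ∈ (gproj_finite hM.1 x).toFinset, gproj hM'.1 i (g (gproj hM.1 i x)) +
      ∑ i ∈ (gproj_finite hM.1 y).toFinset, gproj hM'.1 i (g (gproj hM.1 i y)) := by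
    classical
    let s := (gproj_finite hM.1 (x + y)).toFinset ∪ ((gproj_finite hM.1 x).toFinset ∪
      (gproj_finite hM.1 y).toFinset)
    rw [key (x + y) s (by simp [s]), key x s (by grind), key y s (by grind),
      ← Finset.sum_add_distrib]
    simp only [map_add]
  have hhom (i : ℤ) (x : M) (hx : x ∈ ℳ i) :
      ∑ j ∈ (gproj_finite hM.1 x).toFinset, gproj hM'.1 j (g (gproj hM.1 j x)) =
        gproj hM'.1 i (g x) := by
    rw [key x {i}, Finset.sum_singleton, gproj_of_mem hM.1 hx]
    intro j hj
    by_contra hne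
    have : gproj hM.1 j x ≠ 0 := by simpa using hj
    exact this (gproj_of_ne hM.1 (fun e : i = j => hne (by simp [e])) hx)
  let g' : M →+ M' := AddMonoidHom.mk'
    (fun x => ∑ i ∈ (gproj_finite hM.1 x).toFinset, gproj hM'.1 i (g (gproj hM.1 i x))) hadd
  have hg' (i : ℤ) (x : M) (hx : x ∈ ℳ i) : g' x = gproj hM'.1 i (g x) := hhom i x hx
  refine ⟨{ g' with map_smul' := fun a x => ?_ }, fun i x hx => hhom i x hx⟩
  change g' (a • x) = a • g' x
  induction x using homogeneous_induction hM.1 with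
  | zero => simp
  | hom e y hy =>
    induction a using homogeneous_induction hA with
    | zero => simp
    | hom i b hb =>
      rw [hg' _ _ (hM.2 i e b y hb hy), hg' _ _ hy, map_smul, gproj_smul hM' hb,
        add_sub_cancel_left]
    | add b c hb hc => rw [add_smul, map_add, hb, hc, add_smul]
  | add y z hy hz => rw [smul_add, map_add, hy, hz, map_add, smul_add]

end Homogenize

section Triangular

variable {𝒜 : ℤ → Submodule K A} {Am T Ap : Subalgebra K A}

namespace TriangularDecomposition

variable (h : TriangularDecomposition K A 𝒜 Am T Ap)

include h

theorem isModuleGrading : IsModuleGrading K A 𝒜 𝒜 :=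
  ⟨h.internal, fun i j a x ha hx => h.mul_mem i j a x ha hx⟩

theorem gproj_mem_pos {x : A} (hx : x ∈ Ap) (i : ℤ) : gproj h.internal i x ∈ Ap := by
  have hx' : x ∈ ⨆ i : ℤ, Ap.toSubmodule ⊓ 𝒜 i := h.pos_graded ▸ hx
  refine Submodule.iSup_induction _ (motive := fun x => gproj h.internal i x ∈ Ap) hx'
    (fun j y hy => ?_) (by simp [zero_mem]) fun y z hy hz => by rw [map_add]; exact add_mem hy hz
  by_cases hij : j = i
  · subst hij
    rw [gproj_of_mem _ hy.2]
    exact hy.1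
  · rw [gproj_of_ne _ hij hy.2]
    exact zero_mem _

theorem gproj_mem_neg {x : A} (hx : x ∈ Am) (i : ℤ) : gproj h.internal i x ∈ Am := by
  have hx' : x ∈ ⨆ i : ℤ, Am.toSubmodule ⊓ 𝒜 i := h.neg_graded ▸ hx
  refine Submodule.iSup_induction _ (motive := fun x => gproj h.internal i x ∈ Am) hx'
    (fun j y hy => ?_) (by simp [zero_mem]) fun y z hy hz => by rw [map_add]; exact add_mem hy hz
  by_cases hij : j = i
  · subst hij
    rw [gproj_of_mem _ hy.2]
    exact hy.1
  · rw [gproj_of_ne _ hij hy.2]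
    exact zero_mem _

theorem gproj_pos_of_neg {x : A} (hx : x ∈ Ap) {i : ℤ} (hi : i < 0) :
    gproj h.internal i x = 0 := by
  refine Submodule.iSup_induction _ (motive := fun x => gproj h.internal i x = 0)
    (h.pos_supp hx) (fun n y hy => gproj_of_ne _ (by omega) hy) (by simp)
    fun y z hy hz => by rw [map_add, hy, hz, add_zero]

theorem neg_mem_degLE {x : A} (hx : x ∈ Am) : x ∈ degLE h.internal 0 := by
  intro i hi
  refine Submodule.iSup_induction _ (motive := fun x => gproj h.internal i x = 0)
    (h.neg_supp hx) (fun n y hy => gproj_of_ne _ (by omega) hy) (by simp)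
    fun y z hy hz => by rw [map_add, hy, hz, add_zero]

theorem gproj_zero_pos {x : A} (hx : x ∈ Ap) :
    ∃ c : K, gproj h.internal 0 x = algebraMap K A c := by
  have : gproj h.internal 0 x ∈ Ap.toSubmodule ⊓ 𝒜 0 := ⟨h.gproj_mem_pos hx 0, gproj_mem _ 0 x⟩
  rw [h.pos_deg0] at this
  obtain ⟨c, hc⟩ := Submodule.mem_span_singleton.1 this
  exact ⟨c, by rw [← hc, Algebra.algebraMap_eq_smul_one]⟩

theorem gproj_zero_neg {x : A} (hx : x ∈ Am) :
    ∃ c : K, gproj h.internal 0 x = algebraMap K A c := by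
  have : gproj h.internal 0 x ∈ Am.toSubmodule ⊓ 𝒜 0 := ⟨h.gproj_mem_neg hx 0, gproj_mem _ 0 x⟩
  rw [h.neg_deg0] at this
  obtain ⟨c, hc⟩ := Submodule.mem_span_singleton.1 this
  exact ⟨c, by rw [← hc, Algebra.algebraMap_eq_smul_one]⟩

theorem gproj_mul_left {i : ℤ} {a : A} (ha : a ∈ 𝒜 i) (j : ℤ) (x : A) :
    gproj h.internal j (a * x) = a * gproj h.internal (j - i) x :=
  gproj_smul h.isModuleGrading ha j x

theorem gproj_mul_right {e : ℤ} {x : A} (hx : x ∈ 𝒜 e) (j : ℤ) (a : A) :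
    gproj h.internal j (a * x) = gproj h.internal (j - e) a * x :=
  gproj_smul_of_mem h.internal h.isModuleGrading hx j a

theorem gproj_mul_T {t : A} (ht : t ∈ T) (j : ℤ) (a : A) :
    gproj h.internal j (a * t) = gproj h.internal j a * t := by
  rw [h.gproj_mul_right (h.T_deg0 ht), sub_zero]

end TriangularDecomposition

variable (𝒜 Ap) in
/-- The left ideal generated by the positive-degree part of `A⁺`. -/
def posIdeal : Submodule A A := Submodule.span A {b | b ∈ Ap ∧ ∃ j, 0 < j ∧ b ∈ 𝒜 j}

theorem posIdeal_smul_eq_zero {N : Type u} [AddCommGroup N] [Module A N] {y : N}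
    (hy : ∀ b ∈ Ap, ∀ j, 0 < j → b ∈ 𝒜 j → b • y = 0) : ∀ x ∈ posIdeal 𝒜 Ap, x • y = 0 := by
  intro x hx
  refine Submodule.span_induction (p := fun x _ => x • y = 0)
    (fun b hb => ?_) (by simp)
    (fun y z _ _ hy hz => by rw [add_smul, hy, hz, add_zero])
    (fun b y _ hy => by rw [smul_eq_mul, mul_smul, hy, smul_zero]) hx
  obtain ⟨hb, j, hj, hbj⟩ := hb
  exact hy b hb j hj hbj

theorem Jpos_smul_eq_zero {N : Type u} [AddCommGroup N] [Module A N] {y : N}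
    (hy : ∀ j, 0 < j → ∀ b ∈ 𝒜 j, b • y = 0) : ∀ x ∈ Jpos K A 𝒜 T Ap, x • y = 0 := by
  intro x hx
  refine Submodule.iSup_induction _ (motive := fun x => x • y = 0) hx (fun j b hb => ?_)
    (by simp) fun y z hy hz => by rw [add_smul, hy, hz, add_zero]
  by_cases hj : 0 < j
  · rw [iSup_pos hj] at hb
    exact hy j hj b hb.2
  · rw [iSup_neg hj] at hb
    rw [(Submodule.mem_bot K).1 hb, zero_smul]

theorem mem_Jpos {b : A} (hb : b ∈ Ap) {j : ℤ} (hj : 0 < j) (hbj : b ∈ 𝒜 j) :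
    b ∈ Jpos K A 𝒜 T Ap := by
  refine Submodule.mem_iSup_of_mem j (Submodule.mem_iSup_of_mem hj ⟨?_, hbj⟩)
  have := Submodule.mul_mem_mul (M := Ap.toSubmodule) (N := T.toSubmodule) hb (OneMemClass.one_mem T)
  rwa [mul_one] at this

namespace TriangularDecomposition

variable (h : TriangularDecomposition K A 𝒜 Am T Ap)

include h

theorem gproj_mem_posIdeal {x : A} (hx : x ∈ posIdeal 𝒜 Ap) (i : ℤ) :
    gproj h.internal i x ∈ posIdeal 𝒜 Ap := by
  refine (isGradedSubmodule'_iff h.internal h.isModuleGrading).1 ?_ x hx i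
  refine Submodule.span_le.2 fun b hb => Submodule.subset_span ?_
  obtain ⟨j, -, hj⟩ := hb.2
  exact Set.mem_iUnion.2 ⟨j, Submodule.subset_span hb, hj⟩

theorem gproj_pos_mem_posIdeal {x : A} (hx : x ∈ Ap) {i : ℤ} (hi : 0 < i) :
    gproj h.internal i x ∈ posIdeal 𝒜 Ap :=
  Submodule.subset_span ⟨h.gproj_mem_pos hx i, i, hi, gproj_mem _ i x⟩

theorem sub_gproj_zero_mem_posIdeal {x : A} (hx : x ∈ Ap) :
    x - gproj h.internal 0 x ∈ posIdeal 𝒜 Ap := by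
  refine mem_of_gproj_mem h.internal fun i => ?_
  rw [map_sub]
  rcases lt_trichotomy i 0 with hi | rfl | hi
  · rw [h.gproj_pos_of_neg hx hi, gproj_of_ne _ hi.ne' (gproj_mem _ 0 x), sub_zero]
    exact zero_mem _
  · rw [gproj_of_mem _ (gproj_mem _ 0 x), sub_self]
    exact zero_mem _
  · rw [gproj_of_ne _ hi.ne (gproj_mem _ 0 x), sub_zero]
    exact h.gproj_pos_mem_posIdeal hx hi

theorem posIdeal_mul_T {x t : A} (hx : x ∈ posIdeal 𝒜 Ap) (ht : t ∈ T) :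
    x * t ∈ posIdeal 𝒜 Ap := by
  have key : ∀ y ∈ T.toSubmodule * Ap.toSubmodule, ∀ j : ℤ, 0 < j →
      gproj h.internal j y ∈ posIdeal 𝒜 Ap := by
    intro y hy j hj
    refine Submodule.mul_induction_on hy (fun s hs b hb => ?_) fun y z hy hz => by
      rw [map_add]; exact add_mem hy hz
    rw [h.gproj_mul_left (h.T_deg0 hs), sub_zero]
    exact Submodule.smul_mem _ s (h.gproj_pos_mem_posIdeal hb hj)
  refine Submodule.span_induction (p := fun x _ => x * t ∈ posIdeal 𝒜 Ap) ?_ (by simp)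
    (fun y z _ _ hy hz => by rw [add_mul]; exact add_mem hy hz)
    (fun a y _ hy => by rw [smul_eq_mul, mul_assoc]; exact Submodule.smul_mem _ a hy) hx
  rintro b ⟨hb, j, hj, hbj⟩
  have h1 : b * t ∈ 𝒜 j := by simpa using h.mul_mem j 0 b t hbj (h.T_deg0 ht)
  rw [← gproj_of_mem h.internal h1]
  exact key _ (h.comm_pos ▸ Submodule.mul_mem_mul hb ht) j hj

theorem span_triple {p : A → Prop} (a : A)
    (mul : ∀ m ∈ Am, ∀ t ∈ T, ∀ b ∈ Ap, p (m * t * b)) (zero : p 0)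
    (add : ∀ y z, p y → p z → p (y + z)) : p a := by
  obtain ⟨w, rfl⟩ := h.mul_bij.2 a
  induction w using TensorProduct.induction_on with
  | zero => rwa [map_zero]
  | add y z hy hz => rw [map_add]; exact add _ _ hy hz
  | tmul x b =>
    induction x using TensorProduct.induction_on with
    | zero => rwa [TensorProduct.zero_tmul, map_zero]
    | add y z hy hz => rw [TensorProduct.add_tmul, map_add]; exact add _ _ hy hz
    | tmul m t => exact mul m m.2 t t.2 b b.2

theorem mem_sup_posIdeal (a : A) :
    a ∈ Am.toSubmodule * T.toSubmodule ⊔ (posIdeal 𝒜 Ap).restrictScalars K := by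
  refine h.span_triple a (fun m hm t ht b hb => ?_) (zero_mem _) fun _ _ => add_mem
  obtain ⟨c, hc⟩ := h.gproj_zero_pos hb
  have hdec : m * t * b = c • (m * t) + m * t * (b - gproj h.internal 0 b) := by
    rw [mul_sub, hc, ← Algebra.commutes, ← Algebra.smul_def]
    abel
  rw [hdec]
  exact Submodule.add_mem_sup (Submodule.smul_mem _ c (Submodule.mul_mem_mul hm ht))
    (Submodule.smul_mem (posIdeal 𝒜 Ap) (m * t) (h.sub_gproj_zero_mem_posIdeal hb))

theorem gproj_mem_posIdeal_of_pos (a : A) {i : ℤ} (hi : 0 < i) :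
    gproj h.internal i a ∈ posIdeal 𝒜 Ap := by
  obtain ⟨y, hy, x, hx, rfl⟩ := Submodule.mem_sup.1 (h.mem_sup_posIdeal a)
  rw [map_add]
  refine add_mem ?_ (h.gproj_mem_posIdeal hx i)
  refine Submodule.mul_induction_on hy (fun m hm t ht => ?_) fun y z hy hz => by
      rw [map_add]; exact add_mem hy hz
  rw [h.gproj_mul_T ht, h.neg_mem_degLE hm i hi, zero_mul]
  exact zero_mem _

theorem exists_T_sub_mem_posIdeal (a : A) :
    ∃ t ∈ T, gproj h.internal 0 a - t ∈ posIdeal 𝒜 Ap := by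
  obtain ⟨y, hy, x, hx, rfl⟩ := Submodule.mem_sup.1 (h.mem_sup_posIdeal a)
  have : gproj h.internal 0 y ∈ T := by
    refine Submodule.mul_induction_on hy (fun m hm t ht => ?_) fun y z hy hz => by
      rw [map_add]; exact add_mem hy hz
    obtain ⟨c, hc⟩ := h.gproj_zero_neg hm
    rw [h.gproj_mul_T ht, hc]
    exact MulMemClass.mul_mem (T.algebraMap_mem c) ht
  refine ⟨_, this, ?_⟩
  rw [map_add, add_sub_cancel_left]
  exact h.gproj_mem_posIdeal hx 0

theorem exists_degLE_neg_one (z : A) :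
    ∃ y ∈ degLE h.internal (-1), z - gproj h.internal 0 z - y ∈ posIdeal 𝒜 Ap := by
  induction z using homogeneous_induction h.internal with
  | zero => exact ⟨0, zero_mem _, by simp⟩
  | hom i y hy =>
    rcases lt_trichotomy i 0 with hi | rfl | hi
    · refine ⟨y, mem_degLE_of_mem _ (by omega) hy, ?_⟩
      rw [gproj_of_ne _ hi.ne hy]
      simp
    · refine ⟨0, zero_mem _, ?_⟩
      rw [gproj_of_mem _ hy]
      simp
    · refine ⟨0, zero_mem _, ?_⟩
      rw [gproj_of_ne _ hi.ne' hy, sub_zero, sub_zero, ← gproj_of_mem h.internal hy]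
      exact h.gproj_mem_posIdeal_of_pos y hi
  | add y z hy hz =>
    obtain ⟨y', hy', hy⟩ := hy
    obtain ⟨z', hz', hz⟩ := hz
    refine ⟨y' + z', add_mem hy' hz', ?_⟩
    rw [map_add]
    convert add_mem hy hz using 1
    abel

theorem eq_zero_of_mem_T_of_mem_posIdeal {t : A} (ht : t ∈ T) (hI : t ∈ posIdeal 𝒜 Ap) :
    t = 0 := by
  let e := LinearEquiv.ofBijective _ h.mul_bij
  let pr : A →ₗ[K] A := (LinearMap.mul' K A).comp (TensorProduct.map (mulMap K A Am.toSubmodule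
    T.toSubmodule) (gproj h.internal 0 ∘ₗ Ap.toSubmodule.subtype)) ∘ₗ e.symm.toLinearMap
  have hpr (m t b : A) (hm : m ∈ Am) (ht : t ∈ T) (hb : b ∈ Ap) :
      pr (m * t * b) = m * t * gproj h.internal 0 b := by
    have : e.symm (m * t * b) = ((⟨m, hm⟩ : Am.toSubmodule) ⊗ₜ[K] (⟨t, ht⟩ : T.toSubmodule)) ⊗ₜ[K]
        (⟨b, hb⟩ : Ap.toSubmodule) := by
      rw [LinearEquiv.symm_apply_eq]
      rfl
    change (LinearMap.mul' K A) (TensorProduct.map _ _ (e.symm (m * t * b))) = _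
    rw [this]
    rfl
  have h1 : pr t = t := by
    have := hpr 1 t 1 (OneMemClass.one_mem _) ht (OneMemClass.one_mem _)
    rwa [one_mul, mul_one, gproj_of_mem _ h.one_mem, mul_one] at this
  have h2 : ∀ x ∈ posIdeal 𝒜 Ap, pr x = 0 := by
    intro x hx
    refine Submodule.span_induction (p := fun x _ => ∀ a, pr (a * x) = 0) ?_ (by simp)
      (fun y z _ _ hy hz a => by rw [mul_add, map_add, hy, hz, add_zero])
      (fun b y _ hy a => by rw [smul_eq_mul, ← mul_assoc]; exact hy _) hx 1 |> fun h1 => by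
        simpa using h1
    rintro b ⟨hb, j, hj, hbj⟩ a
    refine h.span_triple (p := fun a => pr (a * b) = 0) a (fun m hm s hs c hc => ?_) (by simp)
      fun y z hy hz => by rw [add_mul, map_add, hy, hz, add_zero]
    rw [mul_assoc, hpr m s _ hm hs (MulMemClass.mul_mem hc hb), h.gproj_mul_right hbj,
      h.gproj_pos_of_neg hc (by omega), zero_mul, mul_zero]
  rw [← h1, h2 t hI]

theorem exists_pow_eq_zero [FiniteDimensional K A] {z : A} (hz : z ∈ degLE h.internal (-1)) :
    ∃ n : ℕ, z ^ n = 0 := by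
  have hpow (n : ℕ) : z ^ n ∈ degLE h.internal (-n : ℤ) := by
    induction n with
    | zero => simpa using mem_degLE_of_mem _ le_rfl h.one_mem
    | succ n ih =>
      rw [pow_succ]
      have := smul_mem_degLE h.internal h.isModuleGrading ih hz
      rwa [smul_eq_mul, show (-(n : ℤ) + -1) = -((n + 1 : ℕ) : ℤ) by push_cast; ring] at this
  obtain ⟨N, hN⟩ := (finite_degrees h.internal).bddBelow
  refine ⟨(1 - N).toNat, gproj_ext h.internal fun i => ?_⟩
  rw [map_zero]
  by_cases hi : 𝒜 i = ⊥
  · have := gproj_mem h.internal i (z ^ (1 - N).toNat)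
    rw [hi] at this
    exact (Submodule.mem_bot K).1 this
  · have := hN hi
    exact hpow _ i (by omega)

end TriangularDecomposition

end Triangular

section Freeness

variable {𝒜 : ℤ → Submodule K A} {Am T Ap : Subalgebra K A}

theorem TriangularDecomposition.free_neg (h : TriangularDecomposition K A 𝒜 Am T Ap) :
    Module.Free Am A := by
  let W := ↥T.toSubmodule ⊗[K] ↥Ap.toSubmodule
  let w : W →ₗ[K] A := mulMap K A T.toSubmodule Ap.toSubmodule
  let f : Am ⊗[K] W →ₗ[Am] A := TensorProduct.AlgebraTensorModule.lift
    (LinearMap.toSpanSingleton Am (W →ₗ[K] A) w)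
  have hf : Function.Bijective f := by
    let e : Am ⊗[K] W ≃ₗ[K] (↥Am.toSubmodule ⊗[K] ↥T.toSubmodule) ⊗[K] ↥Ap.toSubmodule :=
      (TensorProduct.congr Am.toSubmoduleEquiv.symm (LinearEquiv.refl K W)).trans
        (TensorProduct.assoc K _ _ _).symm
    have : f.restrictScalars K =
        triMulMap K A Am.toSubmodule T.toSubmodule Ap.toSubmodule ∘ₗ e.toLinearMap := by
      ext m t b
      exact (mul_assoc (m : A) t b).symm
    have h2 := h.mul_bij.comp e.bijective
    convert h2 using 1
    exact congrArg DFunLike.coe this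
  exact Module.Free.of_basis ((Algebra.TensorProduct.basis Am (Module.Free.chooseBasis K W)).map
    (LinearEquiv.ofBijective f hf))

theorem TriangularDecomposition.projective_neg (h : TriangularDecomposition K A 𝒜 Am T Ap)
    {P : Type u} [AddCommGroup P] [Module A P] [Module.Projective A P] :
    Module.Projective Am P := by
  have := h.free_neg
  obtain ⟨s, hs⟩ := Module.projective_def'.1 ‹Module.Projective A P›
  refine Module.Projective.of_split (M := P →₀ A) (s.restrictScalars Am)
    ((Finsupp.linearCombination A id).restrictScalars Am) ?_
  ext x
  exact LinearMap.congr_fun hs x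

variable {P : Type u} [AddCommGroup P] [Module A P] [Module K P] [IsScalarTower K A P]
  {𝒬 : ℤ → Submodule K P}

theorem mem_degLE_top (hQ : DirectSum.IsInternal 𝒬) {e : ℤ} (he : ∀ i, e < i → 𝒬 i = ⊥) (x : P) :
    x ∈ degLE hQ e := fun i hi => by
  have := gproj_mem hQ i x
  rwa [he i hi, Submodule.mem_bot] at this

theorem TriangularDecomposition.exists_functional (h : TriangularDecomposition K A 𝒜 Am T Ap)
    [Module.Projective A P] (hQ : IsModuleGrading K A 𝒜 𝒬) {e : ℤ}
    (he : ∀ i, e < i → 𝒬 i = ⊥) (l : 𝒬 e →ₗ[K] K) :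
    ∃ f : P →ₗ[Am] Am, ∀ x : 𝒬 e, gproj h.internal 0 (f x : A) = algebraMap K A (l x) := by
  let J : Submodule Am Am :=
    { carrier := {a | gproj h.internal 0 (a : A) = 0}
      add_mem' := fun {a b} ha hb => by
        change gproj h.internal 0 ((a : A) + b) = 0
        rw [map_add, ha, hb, add_zero]
      zero_mem' := map_zero _
      smul_mem' := fun m a ha => by
        have := gproj_smul_degLE h.internal h.isModuleGrading (h.neg_mem_degLE m.2)
          (h.neg_mem_degLE a.2)
        change gproj h.internal 0 ((m : A) * a) = 0
        rw [add_zero, smul_eq_mul] at this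
        rw [this, ha, smul_zero] }
  let p : P →ₗ[K] 𝒬 e := (gproj hQ.1 e).codRestrict (𝒬 e) (gproj_mem hQ.1 e)
  let q : P →ₗ[Am] Am ⧸ J :=
    { toFun := fun x => J.mkQ (algebraMap K Am (l (p x)))
      map_add' := fun x y => by simp only [map_add]
      map_smul' := fun a x => by
        obtain ⟨c, hc⟩ := h.gproj_zero_neg a.2
        have h1 : p (a • x) = c • p x := by
          have := gproj_smul_degLE h.internal hQ (h.neg_mem_degLE a.2) (mem_degLE_top hQ.1 he x)
          rw [zero_add, hc, algebraMap_smul] at this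
          exact Subtype.ext this
        rw [RingHom.id_apply, h1, ← J.mkQ.map_smul, ← sub_eq_zero, ← map_sub]
        rw [Submodule.mkQ_apply, Submodule.Quotient.mk_eq_zero]
        change gproj h.internal 0 (algebraMap K A (l (c • p x)) - (a : A) * algebraMap K A (l (p x)))
          = 0
        rw [map_sub, ← Algebra.commutes, ← Algebra.smul_def, l.map_smul,
          (gproj h.internal 0).map_smul (l (p x)), hc,
          Algebra.algebraMap_eq_smul_one, (gproj h.internal 0).map_smul, gproj_of_mem _ h.one_mem,
          Algebra.algebraMap_eq_smul_one, smul_smul, smul_eq_mul, mul_comm, sub_self] }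
  have := h.projective_neg (P := P)
  obtain ⟨f, hf⟩ := Module.projective_lifting_property J.mkQ q J.mkQ_surjective
  refine ⟨f, fun x => ?_⟩
  have h1 : J.mkQ (f x) = J.mkQ (algebraMap K Am (l (p x))) := LinearMap.congr_fun hf (x : P)
  rw [← sub_eq_zero, ← map_sub, Submodule.mkQ_apply, Submodule.Quotient.mk_eq_zero] at h1
  have h2 : gproj h.internal 0 ((f x : A) - algebraMap K A (l (p x))) = 0 := h1
  have h3 : p x = x := Subtype.ext (gproj_of_mem hQ.1 x.2)
  rw [map_sub, sub_eq_zero, h3, Algebra.algebraMap_eq_smul_one, map_smul,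
    gproj_of_mem _ h.one_mem] at h2
  rw [h2, Algebra.algebraMap_eq_smul_one]

theorem TriangularDecomposition.linearIndependent_top (h : TriangularDecomposition K A 𝒜 Am T Ap)
    [Module.Projective A P] (hQ : IsModuleGrading K A 𝒜 𝒬) {e : ℤ}
    (he : ∀ i, e < i → 𝒬 i = ⊥) {ι : Type*} (b : Module.Basis ι K (𝒬 e)) :
    LinearIndependent Am (fun j => (b j : P)) := by
  classical
  rw [linearIndependent_iff]
  intro a ha
  have key (n : ℕ) : ∀ i, (a i : A) ∈ degLE h.internal (-n : ℤ) := by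
    induction n with
    | zero => exact fun i => by simpa using h.neg_mem_degLE (a i).2
    | succ n ih =>
      intro i
      obtain ⟨f, hf⟩ := h.exists_functional hQ he (b.coord i)
      have h1 : ∑ j ∈ a.support, (a j : A) * (f (b j) : A) = 0 := by
        have := congrArg (fun z => ((f z : Am) : A)) ha
        simpa [Finsupp.linearCombination_apply, Finsupp.sum] using this
      have h2 (j) : (f (b j) : A) - (if j = i then 1 else 0) ∈ degLE h.internal (-1) := by
        intro k hk
        rw [map_sub]
        rcases eq_or_ne k 0 with rfl | hk0
        · rw [hf, Module.Basis.coord_apply, b.repr_self, Finsupp.single_apply]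
          split_ifs
          · rw [map_one, gproj_of_mem _ h.one_mem, sub_self]
          · rw [map_zero, map_zero, sub_zero]
        · rw [h.neg_mem_degLE (f (b j)).2 k (by omega)]
          split_ifs
          · rw [gproj_of_ne _ hk0.symm h.one_mem, sub_zero]
          · rw [map_zero, sub_zero]
      have h3 : (a i : A) = -∑ j ∈ a.support, (a j : A) * ((f (b j) : A) - (if j = i then 1 else 0)) := by
        simp only [mul_sub, Finset.sum_sub_distrib, h1, zero_sub, neg_neg, mul_ite, mul_one, mul_zero]
        rw [Finset.sum_ite_eq']
        split_ifs with hi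
        · rfl
        · rw [Finsupp.notMem_support_iff.1 hi]; rfl
      rw [h3]
      refine neg_mem (sum_mem fun j _ => ?_)
      have := smul_mem_degLE h.internal h.isModuleGrading (ih j) (h2 j)
      rwa [smul_eq_mul, show (-(n : ℤ) + -1) = -((n + 1 : ℕ) : ℤ) by push_cast; ring] at this
  ext i
  refine gproj_ext h.internal fun k => ?_
  rw [key (1 - k).toNat i k (by omega)]
  simp

end Freeness

section Extension

variable {𝒜 : ℤ → Submodule K A} {Am T Ap : Subalgebra K A}

omit [Field K] [Algebra K A] in
theorem injective_of_finite_projective (hself : Module.Injective A A)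
    {P : Type u} [AddCommGroup P] [Module A P] [Module.Projective A P] [Module.Finite A P] :
    Module.Injective A P where
  out X Y _ _ _ _ f hf g := by
    obtain ⟨n, p, i, -, -, hpi⟩ := Module.Finite.exists_comp_eq_id_of_projective A P
    obtain ⟨k, hk⟩ := Module.Injective.out f hf (i ∘ₗ g)
    exact ⟨p ∘ₗ k, fun x => by
      rw [LinearMap.comp_apply, hk]
      exact LinearMap.congr_fun hpi (g x)⟩

variable {P : Type u} [AddCommGroup P] [Module A P] [Module K P] [IsScalarTower K A P]
  {𝒬 : ℤ → Submodule K P}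

/-- A homogeneous component of a graded module, as a `T`-submodule. -/
def TriangularDecomposition.piece (h : TriangularDecomposition K A 𝒜 Am T Ap)
    (hQ : IsModuleGrading K A 𝒜 𝒬) (e : ℤ) : Submodule T P where
  carrier := 𝒬 e
  add_mem' := add_mem
  zero_mem' := zero_mem _
  smul_mem' t x hx := by
    have := hQ.2 0 e t x (h.T_deg0 t.2) hx
    rwa [zero_add] at this

theorem posIdeal_smul_top (hQ : IsModuleGrading K A 𝒜 𝒬) {e : ℤ} (he : ∀ i, e < i → 𝒬 i = ⊥)
    {x : P} (hx : x ∈ 𝒬 e) :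
    ∀ a ∈ posIdeal 𝒜 Ap, a • x = 0 := by
  refine posIdeal_smul_eq_zero fun b _ j hj hb => ?_
  have := hQ.2 j e b x hb hx
  rwa [he _ (by omega), Submodule.mem_bot] at this

theorem TriangularDecomposition.exists_extension (h : TriangularDecomposition K A 𝒜 Am T Ap)
    [Module.Projective A P] (hQ : IsModuleGrading K A 𝒜 𝒬) {e : ℤ}
    (he : ∀ i, e < i → 𝒬 i = ⊥) {P₂ : Type u} [AddCommGroup P₂] [Module A P₂]
    (hP₂ : Module.Injective A P₂) (θ : h.piece hQ e →ₗ[T] P₂)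
    (hθ : ∀ x, ∀ a ∈ posIdeal 𝒜 Ap, a • θ x = 0) :
    ∃ g : P →ₗ[A] P₂, ∀ x : h.piece hQ e, g x = θ x := by
  let W : Submodule Am (P × P₂) :=
    Submodule.span Am (Set.range fun x : h.piece hQ e => ((x : P), θ x))
  have hgen (x : h.piece hQ e) : ((x : P), θ x) ∈ W := Submodule.subset_span ⟨x, rfl⟩
  have hclosed (a : A) (x : h.piece hQ e) : a • ((x : P), θ x) ∈ W := by
    obtain ⟨y, hy, z, hz, rfl⟩ := Submodule.mem_sup.1 (h.mem_sup_posIdeal a)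
    rw [add_smul]
    refine add_mem ?_ ?_
    · refine Submodule.mul_induction_on hy (fun m hm t ht => ?_) fun y z hy hz => by
        rw [add_smul]; exact add_mem hy hz
      have h1 := W.smul_mem ⟨m, hm⟩ (hgen ((⟨t, ht⟩ : T) • x))
      rw [map_smul] at h1
      rw [mul_smul]
      exact h1
    · have : z • ((x : P), θ x) = 0 :=
        Prod.ext (posIdeal_smul_top hQ he x.2 z hz) (hθ x z hz)
      rw [this]
      exact zero_mem _
  let G : Submodule A (P × P₂) :=
    { W with
      smul_mem' := fun a w hw => by
        refine Submodule.span_induction (p := fun w _ => ∀ a : A, a • w ∈ W) ?_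
          (fun a => by rw [smul_zero]; exact zero_mem _)
          (fun y z _ _ hy hz a => by rw [smul_add]; exact add_mem (hy a) (hz a))
          (fun m y _ hy a => ?_) hw a
        · rintro _ ⟨x, rfl⟩ a
          exact hclosed a x
        · have := hy (a * m)
          rwa [mul_smul] at this }
  have hinj : ∀ w ∈ W, w.1 = 0 → w = 0 := by
    intro w hw hw1
    let b := Module.Basis.ofVectorSpace K (𝒬 e)
    have hli := h.linearIndependent_top hQ he b
    have hW : W ≤ Submodule.span Am (Set.range fun j => (((b j : 𝒬 e) : P), θ (b j))) := by
      refine Submodule.span_le.2 ?_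
      rintro _ ⟨x, rfl⟩
      let lθ : 𝒬 e →+ P × P₂ :=
        { toFun := fun y => ((y : P), θ y)
          map_zero' := by
            refine Prod.ext rfl ?_
            exact map_zero θ
          map_add' := fun y z => by
            refine Prod.ext rfl ?_
            exact map_add θ y z }
      have hl (c : K) (y : 𝒬 e) : lθ (c • y) = algebraMap K Am c • lθ y := by
        refine Prod.ext (algebraMap_smul A c (y : P)).symm ?_
        have : θ (c • y : 𝒬 e) = θ (algebraMap K T c • (show h.piece hQ e from y)) :=
          congrArg θ (Subtype.ext (algebraMap_smul A c (y : P)).symm)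
        exact this.trans (map_smul θ _ _)
      have hall (y : 𝒬 e) : lθ y ∈
          Submodule.span Am (Set.range fun j => (((b j : 𝒬 e) : P), θ (b j))) := by
        refine Submodule.span_induction (p := fun y _ => lθ y ∈ _) ?_
          (by rw [map_zero]; exact zero_mem _)
          (fun y z _ _ hy hz => by rw [map_add]; exact add_mem hy hz)
          (fun c y _ hy => by rw [hl]; exact Submodule.smul_mem _ _ hy) (b.mem_span y)
        rintro _ ⟨j, rfl⟩
        exact Submodule.subset_span ⟨j, rfl⟩
      exact hall x
    obtain ⟨a, ha⟩ := (Finsupp.mem_span_range_iff_exists_finsupp).1 (hW hw)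
    have ha1 : Finsupp.linearCombination Am (fun j => ((b j : 𝒬 e) : P)) a = 0 := by
      rw [← hw1, ← ha, Finsupp.linearCombination_apply]
      simp only [Finsupp.sum, Prod.fst_sum, Prod.smul_fst]
    rw [linearIndependent_iff.1 hli a ha1] at ha
    rw [← ha, Finsupp.sum_zero_index]
  obtain ⟨g, hg⟩ := hP₂.out (LinearMap.fst A P P₂ ∘ₗ G.subtype)
    (by
      rw [← LinearMap.ker_eq_bot, LinearMap.ker_eq_bot']
      rintro ⟨w, hw⟩ hw1
      exact Subtype.ext (hinj w hw hw1))
    (LinearMap.snd A P P₂ ∘ₗ G.subtype)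
  exact ⟨g, fun x => hg ⟨_, hgen x⟩⟩

end Extension

section Covers

variable {𝒜 : ℤ → Submodule K A} {Am T Ap : Subalgebra K A}

variable {S : Type u} [AddCommGroup S] [Module A S] [Module K S] [IsScalarTower K A S]
  {𝒮 : ℤ → Submodule K S}

omit [Algebra K A] [IsScalarTower K A S] in
theorem isGradedSubmodule'_span_singleton [Algebra K A] [IsScalarTower K A S] {i : ℤ} {x : S}
    (hx : x ∈ 𝒮 i) : IsGradedSubmodule' K A 𝒮 (Submodule.span A {x}) := by
  refine Submodule.span_le.2 (Set.singleton_subset_iff.2 (Submodule.subset_span ?_))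
  exact Set.mem_iUnion.2 ⟨i, Submodule.mem_span_singleton_self x, hx⟩

theorem isSimpleModule_of_graded (hA : DirectSum.IsInternal 𝒜) (hS : IsModuleGrading K A 𝒜 𝒮)
    (hsimple : ∀ N : Submodule A S, IsGradedSubmodule' K A 𝒮 N → N = ⊥ ∨ N = ⊤) {d : ℤ}
    (hd : ∀ i, d < i → 𝒮 i = ⊥) {s : S} (hs : s ∈ 𝒮 d) (hs0 : s ≠ 0) : IsSimpleModule A S := by
  have hspan {i : ℤ} {x : S} (hx : x ∈ 𝒮 i) (hx0 : x ≠ 0) : Submodule.span A {x} = ⊤ :=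
    (hsimple _ (isGradedSubmodule'_span_singleton hx)).resolve_left
      fun hb => hx0 (Submodule.span_singleton_eq_bot.1 hb)
  have : Nontrivial S := ⟨s, 0, hs0⟩
  have : IsSimpleOrder (Submodule A S) := by
    refine { eq_bot_or_eq_top := fun N => ?_ }
    by_cases hN : N = ⊥
    · exact Or.inl hN
    refine Or.inr (top_le_iff.1 ?_)
    obtain ⟨x, hxN, hx0⟩ := N.ne_bot_iff.1 hN
    have hne : {i | gproj hS.1 i x ≠ 0}.Nonempty := by
      by_contra hempty
      refine hx0 (gproj_ext hS.1 fun i => ?_)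
      by_contra hi
      exact hempty ⟨i, by rwa [map_zero] at hi⟩
    obtain ⟨e, he, hmin⟩ := Set.exists_min_image _ id (gproj_finite hS.1 x) hne
    obtain ⟨b', hb'⟩ := Submodule.mem_span_singleton.1
      (hspan (gproj_mem hS.1 e x) he ▸ Submodule.mem_top (x := s))
    set b := gproj hA (d - e) b'
    have hb : b • gproj hS.1 e x = s := by
      rw [← gproj_smul_of_mem hA hS (gproj_mem hS.1 e x) d b', hb', gproj_of_mem _ hs]
    have hbx : b • x = s := by
      refine gproj_ext hS.1 fun j => ?_
      rw [gproj_smul hS (gproj_mem hA _ _)]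
      rcases lt_trichotomy j d with hj | rfl | hj
      · have : gproj hS.1 (j - (d - e)) x = 0 := by
          by_contra h0
          have : e ≤ j - (d - e) := hmin _ h0
          omega
        rw [this, smul_zero, gproj_of_ne _ hj.ne' hs]
      · rw [sub_sub_cancel, gproj_of_mem _ hs, hb]
      · rw [gproj_of_ne _ hj.ne hs]
        have h1 := gproj_mem hS.1 j (b • x)
        rwa [hd j hj, Submodule.mem_bot, gproj_smul hS (gproj_mem hA _ _)] at h1
    rw [← hspan hs hs0, Submodule.span_singleton_le_iff_mem, ← hbx]
    exact N.smul_mem b hxN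
  exact { toIsSimpleOrder := this }

theorem IsLModule.isSimpleModule {d : ℤ} {Ml : Type u} [AddCommGroup Ml] [Module T Ml]
    [IsSimpleModule T Ml] (hA : DirectSum.IsInternal 𝒜) (hS : IsLModule K A 𝒜 T d Ml S 𝒮) :
    IsSimpleModule A S := by
  obtain ⟨hgr, -, hsimple, hd, ι, hι, hr, -⟩ := hS
  obtain ⟨m, hm⟩ := @exists_ne _ (IsSimpleModule.nontrivial T Ml) 0
  exact isSimpleModule_of_graded hA hgr hsimple hd (hr.subset (Set.mem_range_self m))
    ((map_ne_zero_iff ι hι).2 hm)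

section Local

variable {P : Type u} [AddCommGroup P] [Module A P]

omit [Field K] [Algebra K A] [Module K S] [IsScalarTower K A S] in
theorem comp_eq_zero_of_not_injective [IsNoetherianRing A] [Module.Finite A P]
    [IsSimpleModule A S] {φ : P →ₗ[A] S}
    (hsup : ∀ N : Submodule A P, N ⊔ LinearMap.ker φ = ⊤ → N = ⊤) {u : P →ₗ[A] P}
    (hu : ¬ Function.Injective u) : φ ∘ₗ u = 0 := by
  have hns : LinearMap.range u ≠ ⊤ := fun hr =>
    hu (IsNoetherian.injective_of_surjective_endomorphism u (LinearMap.range_eq_top.1 hr))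
  by_contra hne
  rcases eq_bot_or_eq_top (LinearMap.range (φ ∘ₗ u)) with hb | ht
  · exact hne (LinearMap.range_eq_bot.1 hb)
  · refine hns (hsup _ (eq_top_iff.2 fun x _ => ?_))
    obtain ⟨y, hy⟩ := LinearMap.range_eq_top.1 ht (φ x)
    rw [← add_sub_cancel (u y) x]
    refine Submodule.add_mem_sup ⟨y, rfl⟩ ?_
    rw [LinearMap.mem_ker, map_sub, ← hy]
    exact sub_self _

omit [Field K] [Algebra K A] [Module K S] [IsScalarTower K A S] in
theorem false_of_fixed_of_killed [IsNoetherianRing A] [Module.Finite A P] [IsSimpleModule A S]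
    {φ : P →ₗ[A] S} (hφ : Function.Surjective φ)
    (hsup : ∀ N : Submodule A P, N ⊔ LinearMap.ker φ = ⊤ → N = ⊤) {u : P →ₗ[A] P} {x y : P}
    (hx : x ≠ 0) (hux : u x = 0) (hy : y ≠ 0) (huy : u y = y) : False := by
  have h1 : φ ∘ₗ u = 0 := comp_eq_zero_of_not_injective hsup fun hinj =>
    hx (hinj (hux.trans (map_zero u).symm))
  have h2 : φ ∘ₗ (LinearMap.id - u) = 0 := comp_eq_zero_of_not_injective hsup fun hinj =>
    hy (hinj ((map_zero (LinearMap.id - u : P →ₗ[A] P)).symm ▸ by simp [huy]))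
  obtain ⟨s, hs⟩ := @exists_ne _ (IsSimpleModule.nontrivial A S) 0
  obtain ⟨z, rfl⟩ := hφ s
  have h3 := LinearMap.congr_fun h1 z
  have h4 := LinearMap.congr_fun h2 z
  simp only [LinearMap.comp_apply, LinearMap.sub_apply, LinearMap.id_apply, map_sub,
    LinearMap.zero_apply] at h3 h4
  rw [h3, sub_zero] at h4
  exact hs h4

end Local

end Covers

section Top

variable {𝒜 : ℤ → Submodule K A} {Am T Ap : Subalgebra K A}

variable {S : Type u} [AddCommGroup S] [Module A S] [Module K S] [IsScalarTower K A S]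
  {𝒮 : ℤ → Submodule K S} {P : Type u} [AddCommGroup P] [Module A P] [Module K P]
  [IsScalarTower K A P] {𝒬 : ℤ → Submodule K P} {φ : P →ₗ[A] S}

theorem IsGradedProjectiveCover.false_of_fixed_of_killed [IsNoetherianRing A] [IsSimpleModule A S]
    (hP : IsGradedProjectiveCover K A 𝒜 S 𝒮 P 𝒬 φ) {u : P →ₗ[A] P} {x y : P}
    (hx : x ≠ 0) (hux : u x = 0) (hy : y ≠ 0) (huy : u y = y) : False :=
  have := hP.2.2.1
  TriangularPaper.false_of_fixed_of_killed hP.2.2.2.1 hP.2.2.2.2.2 hx hux hy huy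

theorem IsGradedProjectiveCover.injective (hself : Module.Injective A A)
    (hP : IsGradedProjectiveCover K A 𝒜 S 𝒮 P 𝒬 φ) : Module.Injective A P :=
  have := hP.2.1
  have := hP.2.2.1
  injective_of_finite_projective hself

theorem IsGradedProjectiveCover.isSimpleModule_piece [FiniteDimensional K A]
    (h : TriangularDecomposition K A 𝒜 Am T Ap) (hT : IsSemisimpleRing T)
    (hself : Module.Injective A A) [IsSimpleModule A S]
    (hP : IsGradedProjectiveCover K A 𝒜 S 𝒮 P 𝒬 φ) {e : ℤ} (he : ∀ i, e < i → 𝒬 i = ⊥)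
    (hne : 𝒬 e ≠ ⊥) : IsSimpleModule T (h.piece hP.1 e) := by
  have : IsNoetherianRing A := isNoetherian_of_tower K inferInstance
  have := hP.2.1
  have : Nontrivial (h.piece hP.1 e) := by
    obtain ⟨x, hx, hx0⟩ := (𝒬 e).ne_bot_iff.1 hne
    exact ⟨⟨x, hx⟩, 0, fun h0 => hx0 (congrArg Subtype.val h0)⟩
  have : IsSimpleOrder (Submodule T (h.piece hP.1 e)) := by
    refine { eq_bot_or_eq_top := fun N => ?_ }
    by_contra! hN
    obtain ⟨N', hN'⟩ := exists_isCompl N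
    have hN'0 : N' ≠ ⊥ := fun h0 => hN.2 (by simpa [h0] using hN'.sup_eq_top)
    obtain ⟨x, hxN', hx0⟩ := N'.ne_bot_iff.1 hN'0
    obtain ⟨y, hyN, hy0⟩ := N.ne_bot_iff.1 hN.1
    obtain ⟨g, hg⟩ := h.exists_extension hP.1 he (hP.injective hself)
      ((h.piece hP.1 e).subtype ∘ₗ N.subtype ∘ₗ N.projectionOnto N' hN')
      fun z a ha => posIdeal_smul_top hP.1 he (Subtype.property _) a ha
    refine hP.false_of_fixed_of_killed (u := g) (x := x) (y := y) (fun h0 => hx0 (Subtype.ext h0)) ?_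
      (fun h0 => hy0 (Subtype.ext h0)) ?_
    · rw [hg]
      change (((N.projectionOnto N' hN' x : N) : h.piece hP.1 e) : P) = 0
      rw [(Submodule.projectionOnto_apply_eq_zero_iff hN').2 hxN']
      rfl
    · rw [hg]
      change (((N.projectionOnto N' hN' ((⟨y, hyN⟩ : N) : h.piece hP.1 e) : N) : h.piece hP.1 e) : P)
        = _
      rw [Submodule.projectionOnto_apply_left hN' ⟨y, hyN⟩]
  exact { toIsSimpleOrder := this }

end Top

section HighestWeight

variable {𝒜 : ℤ → Submodule K A} {Am T Ap : Subalgebra K A}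

variable {P : Type u} [AddCommGroup P] [Module A P] [Module K P] [IsScalarTower K A P]
  {𝒬 : ℤ → Submodule K P}

/-- The top nonzero component of `𝒬` is in degree `d'`, and is isomorphic to `M` over `T`. -/
def IsTop (T : Subalgebra K A) (𝒬 : ℤ → Submodule K P) (M : Type u) [AddCommGroup M] [Module T M]
    (d' : ℤ) : Prop :=
  (∀ i, d' < i → 𝒬 i = ⊥) ∧
    ∃ ι : M →ₗ[T] P, Function.Injective ι ∧ Set.range ι = (𝒬 d' : Set P)

theorem factorPiece_subset_zero_iff {R Q : Submodule A P} {i : ℤ} :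
    factorPiece K A 𝒬 R Q i ⊆ {0} ↔ ∀ x ∈ 𝒬 i, x ∈ Q → x ∈ R := by
  constructor
  · intro h x hx hxQ
    have := h ⟨⟨x, hxQ⟩, hx, rfl⟩
    rw [Set.mem_singleton_iff, Submodule.mkQ_apply, Submodule.Quotient.mk_eq_zero] at this
    exact this
  · rintro h _ ⟨x, hx, rfl⟩
    rw [Set.mem_singleton_iff, Submodule.mkQ_apply, Submodule.Quotient.mk_eq_zero]
    exact h x hx x.2

theorem exists_jump {n : ℕ} {F : Fin (n + 1) → Submodule A P} (h0 : F 0 = ⊥)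
    (hlast : F (Fin.last n) = ⊤) {x : P} (hx : x ≠ 0) :
    ∃ k : Fin n, x ∈ F k.succ ∧ x ∉ F k.castSucc := by
  by_contra! hno
  have (j : Fin (n + 1)) : x ∉ F j := by
    induction j using Fin.induction with
    | zero => rwa [h0, Submodule.mem_bot]
    | succ k ih => exact fun hk => ih (hno k hk)
  exact this (Fin.last n) (hlast ▸ Submodule.mem_top)

omit [IsScalarTower K A P] in
theorem IsTop.mem_or_disjoint {M : Type u} [AddCommGroup M] [Module T M] [IsSimpleModule T M]
    {d' : ℤ} (ht : IsTop T 𝒬 M d') (N : Submodule A P) :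
    (∀ x ∈ 𝒬 d', x ∈ N) ∨ ∀ x ∈ 𝒬 d', x ∈ N → x = 0 := by
  obtain ⟨-, ι, hι, hr⟩ := ht
  rcases eq_bot_or_eq_top ((N.restrictScalars T).comap ι) with hb | htop
  · right
    intro x hx hxN
    obtain ⟨m, rfl⟩ := hr.superset hx
    have : m ∈ (N.restrictScalars T).comap ι := hxN
    rw [hb, Submodule.mem_bot] at this
    rw [this, map_zero]
  · left
    intro x hx
    obtain ⟨m, rfl⟩ := hr.superset hx
    have : m ∈ (N.restrictScalars T).comap ι := htop ▸ Submodule.mem_top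
    exact this

omit [IsScalarTower K A P] in
theorem IsTop.exists_ne_zero {M : Type u} [AddCommGroup M] [Module T M] [IsSimpleModule T M]
    {d' : ℤ} (ht : IsTop T 𝒬 M d') : ∃ x ∈ 𝒬 d', x ≠ 0 := by
  obtain ⟨-, ι, hι, hr⟩ := ht
  obtain ⟨m, hm⟩ := @exists_ne _ (IsSimpleModule.nontrivial T M) 0
  exact ⟨ι m, hr.subset (Set.mem_range_self m), (map_ne_zero_iff ι hι).2 hm⟩

theorem IsTop.mem_of_jump {M : Type u} [AddCommGroup M] [Module T M] [IsSimpleModule T M]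
    {d' : ℤ} (ht : IsTop T 𝒬 M d') {R Q : Submodule A P}
    (hj : ¬ factorPiece K A 𝒬 R Q d' ⊆ {0}) :
    (∀ x ∈ 𝒬 d', x ∈ Q) ∧ ∀ x ∈ 𝒬 d', x ∈ R → x = 0 := by
  rw [factorPiece_subset_zero_iff] at hj
  push Not at hj
  obtain ⟨x, hx, hxQ, hxR⟩ := hj
  refine ⟨(ht.mem_or_disjoint Q).resolve_right fun h => ?_,
    (ht.mem_or_disjoint R).resolve_left fun h => hxR (h x hx)⟩
  exact hxR (h x hx hxQ ▸ zero_mem _)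

theorem IsTop.isHighestWeightOf {M : Type u} [AddCommGroup M] [Module T M] [IsSimpleModule T M]
    {d' : ℤ} (ht : IsTop T 𝒬 M d') : IsHighestWeightOf K A 𝒜 T P 𝒬 M d' := by
  rintro n F ⟨hmono, h0, hlast, -, -⟩
  have hvanish (k : Fin n) (i : ℤ) (hi : d' < i) :
      factorPiece K A 𝒬 (F k.castSucc) (F k.succ) i ⊆ {0} := by
    rw [factorPiece_subset_zero_iff]
    intro x hx _
    rw [ht.1 i hi, Submodule.mem_bot] at hx
    exact hx ▸ zero_mem _
  refine ⟨hvanish, ?_, fun k hk => ?_⟩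
  · obtain ⟨x, hx, hx0⟩ := ht.exists_ne_zero
    obtain ⟨k, hk⟩ := exists_jump h0 hlast hx0
    refine ⟨k, ?_, ?_⟩
    · exact fun hall => hk.2 (factorPiece_subset_zero_iff.1 hall x hx hk.1)
    · intro k' hk'
      have h1 := ht.mem_of_jump hk'
      rcases lt_trichotomy k' k with hlt | rfl | hlt
      · exact absurd (hmono (Fin.succ_le_castSucc_iff.2 hlt) (h1.1 x hx)) hk.2
      · rfl
      · exact absurd (h1.2 x hx (hmono (Fin.succ_le_castSucc_iff.2 hlt) hk.1)) hx0
  · have h1 := ht.mem_of_jump hk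
    refine ⟨hvanish k, ?_⟩
    obtain ⟨-, ι, hι, hr⟩ := ht
    have hmem (m : M) : ι m ∈ 𝒬 d' := hr.subset (Set.mem_range_self m)
    let q := (Submodule.comap (F k.succ).subtype (F k.castSucc)).mkQ
    let ιh : M →+ _ := AddMonoidHom.mk' (fun m => q ⟨ι m, h1.1 _ (hmem m)⟩) fun m m' => by
      rw [← map_add]
      congr 1
      exact Subtype.ext (map_add ι m m')
    refine ⟨ιh, ?_, ?_, fun t m => ?_⟩
    · refine (injective_iff_map_eq_zero ιh).2 fun m hm => ?_
      have h2 : q ⟨ι m, h1.1 _ (hmem m)⟩ = 0 := hm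
      rw [Submodule.mkQ_apply, Submodule.Quotient.mk_eq_zero] at h2
      exact hι ((h1.2 _ (hmem m) h2).trans (map_zero ι).symm)
    · ext y
      constructor
      · rintro ⟨m, rfl⟩
        exact ⟨⟨ι m, _⟩, hmem m, rfl⟩
      · rintro ⟨x, hx, rfl⟩
        obtain ⟨m, hm⟩ := hr.superset hx
        exact ⟨m, congrArg q (Subtype.ext hm)⟩
    · change q _ = (t : A) • q _
      rw [← map_smul]
      congr 1
      exact Subtype.ext (map_smul ι t m)

theorem factor_eq_bot_or_eq_top {R Q : {N : Submodule A P // IsGradedSubmodule' K A 𝒬 N}}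
    (hRQ : R ⋖ Q) (N : Submodule A (↥Q.1 ⧸ Submodule.comap Q.1.subtype R.1))
    (hN : N ≤ Submodule.span A (⋃ i : ℤ, (N : Set _) ∩ factorPiece K A 𝒬 R.1 Q.1 i)) :
    N = ⊥ ∨ N = ⊤ := by
  let q := (Submodule.comap Q.1.subtype R.1).mkQ
  let N' : Submodule A P := (N.comap q).map Q.1.subtype
  have hmem (x : Q.1) : (x : P) ∈ N' ↔ q x ∈ N := by
    constructor
    · rintro ⟨y, hy, hyx⟩
      have : y = x := Subtype.ext hyx
      exact this ▸ hy
    · exact fun hx => ⟨x, hx, rfl⟩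
  have hzero (x : Q.1) (hx : (x : P) ∈ R.1) : q x = 0 := by
    rw [Submodule.mkQ_apply, Submodule.Quotient.mk_eq_zero]
    exact hx
  have hRN : R.1 ≤ N' := fun x hx =>
    (hmem ⟨x, hRQ.le hx⟩).2 (by rw [hzero _ hx]; exact zero_mem N)
  have hNQ : N' ≤ Q.1 := by
    rintro _ ⟨y, -, rfl⟩
    exact y.2
  have hgr : IsGradedSubmodule' K A 𝒬 N' := by
    set G := Submodule.span A (⋃ i : ℤ, (N' : Set P) ∩ ↑(𝒬 i)) with hG
    have hRG : R.1 ≤ G := fun x hx => Submodule.span_mono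
      (Set.iUnion_mono fun i => Set.inter_subset_inter_left _ hRN) (R.2 hx)
    have hNG : N ≤ (G.comap Q.1.subtype).map q := by
      refine hN.trans (Submodule.span_le.2 (Set.iUnion_subset fun i => ?_))
      rintro _ ⟨hy, x, hx, rfl⟩
      exact ⟨x, Submodule.subset_span (Set.mem_iUnion.2 ⟨i, (hmem x).2 hy, hx⟩), rfl⟩
    intro x hx
    obtain ⟨y, hy, hyx⟩ := hNG ((hmem ⟨x, hNQ hx⟩).1 hx)
    have hsub : x - y ∈ R.1 := by
      have h1 : q (⟨x, hNQ hx⟩ - y) = 0 := by rw [map_sub, hyx, sub_self]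
      rw [Submodule.mkQ_apply, Submodule.Quotient.mk_eq_zero] at h1
      exact h1
    have := G.add_mem (hRG hsub) hy
    rwa [Submodule.subtype_apply, sub_add_cancel] at this
  rcases hRQ.eq_or_eq (c := ⟨N', hgr⟩) hRN hNQ with heq | heq
  · left
    rw [eq_bot_iff]
    intro y hy
    obtain ⟨x, rfl⟩ := Submodule.mkQ_surjective _ y
    have : (x : P) ∈ R.1 := by
      rw [← heq]
      exact (hmem x).2 hy
    rw [Submodule.mem_bot]
    exact hzero x this
  · right
    rw [eq_top_iff]
    intro y _
    obtain ⟨x, rfl⟩ := Submodule.mkQ_surjective _ y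
    refine (hmem x).1 ?_
    exact (congrArg Subtype.val heq).ge x.2

theorem exists_isGradedCompSeries [IsNoetherianRing A] [IsArtinianRing A] [Module.Finite A P]
    (htop : IsGradedSubmodule' K A 𝒬 (⊤ : Submodule A P)) :
    ∃ (n : ℕ) (F : Fin (n + 1) → Submodule A P), IsGradedCompSeries K A 𝒜 𝒬 n F := by
  obtain ⟨a, ha0, n, han, hcov⟩ :=
    exists_covBy_seq_of_wellFoundedLT_wellFoundedGT_of_le
      (α := {N : Submodule A P // IsGradedSubmodule' K A 𝒬 N})
      (x := ⟨⊥, by rintro x rfl; exact zero_mem _⟩) (y := ⟨⊤, htop⟩) (bot_le (a := (⊤ : Submodule A P)))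
  refine ⟨n, fun k => (a k).1, ?_, ?_, ?_, fun k => (a k).2, fun k => ⟨?_, ?_⟩⟩
  · refine Fin.monotone_iff_le_succ.2 fun k => ?_
    exact (hcov k k.2).le
  · exact congrArg Subtype.val ha0
  · exact congrArg Subtype.val han
  · obtain ⟨x, hx, hx'⟩ := SetLike.exists_of_lt (Subtype.coe_lt_coe.2 (hcov k k.2).lt)
    refine ⟨Submodule.Quotient.mk ⟨x, hx⟩, 0, fun h0 => hx' ?_⟩
    rwa [Submodule.Quotient.mk_eq_zero] at h0
  · exact factor_eq_bot_or_eq_top (hcov k k.2)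

theorem IsHighestWeightOf.isTop [IsNoetherianRing A] [IsArtinianRing A] [Module.Finite A P]
    (h : TriangularDecomposition K A 𝒜 Am T Ap) (hQ : IsModuleGrading K A 𝒜 𝒬)
    {M : Type u} [AddCommGroup M] [Module T M] {d' : ℤ}
    (hw : IsHighestWeightOf K A 𝒜 T P 𝒬 M d') : IsTop T 𝒬 M d' := by
  obtain ⟨n, F, hF⟩ := exists_isGradedCompSeries (𝒜 := 𝒜)
    ((isGradedSubmodule'_iff h.internal hQ).2 fun x _ i => Submodule.mem_top)
  obtain ⟨hvanish, ⟨k, hk, huniq⟩, hfac⟩ := hw n F hF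
  obtain ⟨-, ιh, hιh, hrh, hlin⟩ := hfac k hk
  obtain ⟨hmono, h0, hlast, -, -⟩ := hF
  refine ⟨fun i hi => ?_, ?_⟩
  · by_contra hne
    obtain ⟨x, hx, hx0⟩ := (𝒬 i).ne_bot_iff.1 hne
    obtain ⟨k, hk⟩ := exists_jump h0 hlast hx0
    exact hk.2 (factorPiece_subset_zero_iff.1 (hvanish k i hi) x hx hk.1)
  have hother (k' : Fin n) (hk' : k' ≠ k) (x : P) (hx : x ∈ 𝒬 d') (hxF : x ∈ F k'.succ) :
      x ∈ F k'.castSucc := by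
    by_contra hxF'
    exact hk' (huniq k' fun hsub => hxF' (factorPiece_subset_zero_iff.1 hsub x hx hxF))
  have hup (x : P) (hx : x ∈ 𝒬 d') : x ∈ F k.succ := by
    by_cases hx0 : x = 0
    · exact hx0 ▸ zero_mem _
    obtain ⟨j, hj⟩ := exists_jump h0 hlast hx0
    by_cases hjk : j = k
    · exact hjk ▸ hj.1
    · exact absurd (hother j hjk x hx hj.1) hj.2
  have hdown (x : P) (hx : x ∈ 𝒬 d') (hxF : x ∈ F k.castSucc) : x = 0 := by
    by_contra hx0
    obtain ⟨j, hj⟩ := exists_jump h0 hlast hx0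
    by_cases hjk : j = k
    · exact hj.2 (hjk ▸ hxF)
    · exact absurd (hother j hjk x hx hj.1) hj.2
  let q := (Submodule.comap (F k.succ).subtype (F k.castSucc)).mkQ
  let π : h.piece hQ d' →ₗ[T] (↥(F k.succ) ⧸ (Submodule.comap (F k.succ).subtype (F k.castSucc))) :=
    { toFun := fun x => q ⟨x, hup x x.2⟩
      map_add' := fun x y => (map_add q ⟨x, hup x x.2⟩ ⟨y, hup y y.2⟩)
      map_smul' := fun t x => map_smul q (t : A) ⟨x, hup x x.2⟩ }
  have hπ : Function.Injective π := by
    refine (injective_iff_map_eq_zero π).2 fun x hx => ?_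
    have h2 : q ⟨x, hup x x.2⟩ = 0 := hx
    rw [Submodule.mkQ_apply, Submodule.Quotient.mk_eq_zero] at h2
    exact Subtype.ext (hdown x x.2 h2)
  have hr (m : M) : ιh m ∈ LinearMap.range π := by
    obtain ⟨x, hx, hxm⟩ := hrh.subset (Set.mem_range_self m)
    exact ⟨⟨x, hx⟩, hxm⟩
  let ι' : M →ₗ[T] LinearMap.range π :=
    { toFun := fun m => ⟨ιh m, hr m⟩
      map_add' := fun m m' => Subtype.ext (map_add ιh m m')
      map_smul' := fun t m => Subtype.ext (hlin t m) }
  let ι := (h.piece hQ d').subtype ∘ₗ (LinearEquiv.ofInjective π hπ).symm.toLinearMap ∘ₗ ι'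
  refine ⟨ι, ?_, ?_⟩
  · intro m m' hmm
    have h1 := (LinearEquiv.ofInjective π hπ).symm.injective (Subtype.ext hmm)
    exact hιh (congrArg Subtype.val h1)
  · ext x
    constructor
    · rintro ⟨m, rfl⟩
      exact ((LinearEquiv.ofInjective π hπ).symm (ι' m)).2
    · intro hx
      obtain ⟨m, hm⟩ := hrh.superset ⟨⟨x, hup x hx⟩, hx, rfl⟩
      refine ⟨m, ?_⟩
      have : ι' m = LinearEquiv.ofInjective π hπ ⟨x, hx⟩ := Subtype.ext hm
      change (((LinearEquiv.ofInjective π hπ).symm (ι' m) : h.piece hQ d') : P) = x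
      rw [this, LinearEquiv.symm_apply_apply]

end HighestWeight

section SimpleModules

variable {𝒜 : ℤ → Submodule K A} {Am T Ap : Subalgebra K A}

namespace TriangularDecomposition

variable (h : TriangularDecomposition K A 𝒜 Am T Ap)

/-- The left ideal of all `x` such that, modulo the positive part of `A⁺`, the degree `0`
component of every left multiple of `x` lies in the left ideal `m` of `T`. When `m` is maximal,
the quotient is the simple graded module `L(T ⧸ m)`. -/
def inflate (m : Submodule T T) : Submodule A A where
  carrier := {x | ∀ a : A, ∃ t ∈ m, gproj h.internal 0 (a * x) - (t : A) ∈ posIdeal 𝒜 Ap}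
  zero_mem' a := ⟨0, zero_mem m, by simp⟩
  add_mem' := by
    intro x y hx hy a
    obtain ⟨t, ht, htx⟩ := hx a
    obtain ⟨s, hs, hsy⟩ := hy a
    refine ⟨t + s, add_mem ht hs, ?_⟩
    have := add_mem htx hsy
    rwa [← add_sub_add_comm, ← map_add, ← mul_add] at this
  smul_mem' b x hx a := by
    rw [smul_eq_mul, ← mul_assoc]
    exact hx (a * b)

theorem mem_inflate {m : Submodule T T} {x : A} : x ∈ h.inflate m ↔
    ∀ a : A, ∃ t ∈ m, gproj h.internal 0 (a * x) - (t : A) ∈ posIdeal 𝒜 Ap := Iff.rfl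

theorem gproj_mem_inflate {m : Submodule T T} (x : A) (hx : x ∈ h.inflate m) (i : ℤ) :
    gproj h.internal i x ∈ h.inflate m := by
  intro a
  obtain ⟨t, ht, htx⟩ := hx (gproj h.internal (-i) a)
  refine ⟨t, ht, ?_⟩
  rw [h.gproj_mul_left (gproj_mem _ (-i) a), sub_neg_eq_add, zero_add] at htx
  rwa [h.gproj_mul_right (gproj_mem _ i x), zero_sub]

theorem posIdeal_le_inflate (m : Submodule T T) : posIdeal 𝒜 Ap ≤ h.inflate m := by
  intro x hx a
  refine ⟨0, zero_mem m, ?_⟩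
  rw [ZeroMemClass.coe_zero, sub_zero]
  exact h.gproj_mem_posIdeal (Submodule.smul_mem _ a hx) 0

theorem coe_mem_inflate {m : Submodule T T} {t : T} : (t : A) ∈ h.inflate m ↔ t ∈ m := by
  constructor
  · intro ht
    obtain ⟨s, hs, hst⟩ := ht 1
    rw [one_mul, gproj_of_mem _ (h.T_deg0 t.2)] at hst
    have := h.eq_zero_of_mem_T_of_mem_posIdeal (sub_mem t.2 s.2) hst
    rwa [Subtype.ext (sub_eq_zero.1 this)]
  · intro ht a
    obtain ⟨s, hs, hsa⟩ := h.exists_T_sub_mem_posIdeal a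
    refine ⟨⟨s, hs⟩ * t, m.smul_mem ⟨s, hs⟩ ht, ?_⟩
    rw [h.gproj_mul_T t.2]
    have := h.posIdeal_mul_T hsa t.2
    rwa [sub_mul] at this

theorem one_notMem_inflate {m : Submodule T T} (hm : m ≠ ⊤) : (1 : A) ∉ h.inflate m := by
  intro h1
  refine hm ((Ideal.eq_top_iff_one m).2 ?_)
  refine h.coe_mem_inflate.1 ?_
  rwa [Subalgebra.coe_one]

theorem mem_inflate_of_pos (m : Submodule T T) {i : ℤ} (hi : 0 < i) {x : A} (hx : x ∈ 𝒜 i) :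
    x ∈ h.inflate m := by
  rw [← gproj_of_mem h.internal hx]
  exact h.posIdeal_le_inflate m (h.gproj_mem_posIdeal_of_pos x hi)

theorem exists_sub_mem_inflate (m : Submodule T T) {x : A} (hx : x ∈ 𝒜 0) :
    ∃ t : T, x - t ∈ h.inflate m := by
  obtain ⟨t, ht, hxt⟩ := h.exists_T_sub_mem_posIdeal x
  rw [gproj_of_mem _ hx] at hxt
  exact ⟨⟨t, ht⟩, h.posIdeal_le_inflate m hxt⟩

theorem exists_mul_sub_one_mem_inflate {m : Submodule T T} (hm : IsCoatom m) {i : ℤ} {x : A}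
    (hx : x ∈ 𝒜 i) (hxm : x ∉ h.inflate m) : ∃ a ∈ 𝒜 (-i), a * x - 1 ∈ h.inflate m := by
  rw [mem_inflate] at hxm
  push Not at hxm
  obtain ⟨a, ha⟩ := hxm
  rw [h.gproj_mul_right hx, zero_sub] at ha
  have hdeg := h.mul_mem _ _ _ _ (gproj_mem h.internal (-i) a) hx
  rw [neg_add_cancel] at hdeg
  obtain ⟨t, ht, hxt⟩ := h.exists_T_sub_mem_posIdeal (gproj h.internal (-i) a * x)
  rw [gproj_of_mem _ hdeg] at hxt
  have htm : (⟨t, ht⟩ : T) ∉ m := fun htm => ha _ htm hxt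
  have hsup : m ⊔ Submodule.span T {(⟨t, ht⟩ : T)} = ⊤ :=
    hm.2 _ (left_lt_sup.2 fun hle => htm (hle (Submodule.mem_span_singleton_self _)))
  obtain ⟨r, hr, y, hy, hry⟩ := Submodule.mem_sup.1 (hsup.ge (Submodule.mem_top (x := (1 : T))))
  obtain ⟨s, rfl⟩ := Submodule.mem_span_singleton.1 hy
  refine ⟨s * gproj h.internal (-i) a, ?_, ?_⟩
  · have := h.mul_mem _ _ _ _ (h.T_deg0 s.2) (gproj_mem h.internal (-i) a)
    rwa [zero_add] at this
  · have h1 : (1 : A) = r + s * t := congrArg Subtype.val hry.symm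
    have h2 := sub_mem ((h.inflate m).smul_mem (s : A) (h.posIdeal_le_inflate m hxt))
      (h.coe_mem_inflate.2 hr)
    rw [smul_eq_mul, mul_sub, ← mul_assoc, sub_sub, add_comm (_ * _), ← h1] at h2
    exact h2

theorem isLModule_inflate {m : Submodule T T} (hm : IsCoatom m) :
    IsLModule K A 𝒜 T 0 (T ⧸ m) (A ⧸ h.inflate m) (quotGrading 𝒜 (h.inflate m)) := by
  have hgr := isModuleGrading_quot h.isModuleGrading (N := h.inflate m) h.gproj_mem_inflate
  refine ⟨hgr, ?_, fun N hN => ?_, fun i hi => ?_, ?_⟩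
  · exact Submodule.Quotient.nontrivial_iff.2 fun htop =>
      h.one_notMem_inflate hm.1 (htop ▸ Submodule.mem_top)
  · rw [isGradedSubmodule'_iff h.internal hgr] at hN
    by_contra! hN'
    obtain ⟨y, hy, hy0⟩ := N.ne_bot_iff.1 hN'.1
    have : ∃ i, gproj hgr.1 i y ≠ 0 := by
      by_contra! hall
      exact hy0 (gproj_ext hgr.1 fun i => by rw [hall i, map_zero])
    obtain ⟨i, hi⟩ := this
    obtain ⟨x, hx, hxy⟩ := gproj_mem hgr.1 i y
    have hxN : (h.inflate m).mkQ x ∈ N := by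
      have := hN y hy i
      rwa [← hxy] at this
    have hxm : x ∉ h.inflate m := by
      intro hxm
      rw [← hxy] at hi
      exact hi ((Submodule.Quotient.mk_eq_zero _).2 hxm)
    obtain ⟨a, -, ha⟩ := h.exists_mul_sub_one_mem_inflate hm hx hxm
    have h1 : (h.inflate m).mkQ 1 ∈ N := by
      have h2 := N.smul_mem a hxN
      rwa [← map_smul, smul_eq_mul, Submodule.mkQ_apply, (Submodule.Quotient.eq _).2 ha] at h2
    refine hN'.2 (eq_top_iff.2 fun z _ => ?_)
    obtain ⟨b, rfl⟩ := Submodule.mkQ_surjective _ z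
    have h3 := N.smul_mem b h1
    rwa [← map_smul, smul_eq_mul, mul_one] at h3
  · rw [eq_bot_iff]
    rintro _ ⟨x, hx, rfl⟩
    exact (Submodule.Quotient.mk_eq_zero _).2 (h.mem_inflate_of_pos m hi hx)
  · let j : T →ₗ[T] A ⧸ h.inflate m := LinearMap.toSpanSingleton T _ ((h.inflate m).mkQ 1)
    have hj (t : T) : j t = (h.inflate m).mkQ (t : A) := by
      change (t : A) • (h.inflate m).mkQ 1 = _
      rw [← map_smul, smul_eq_mul, mul_one]
    have hker (t : T) : j t = 0 ↔ t ∈ m := by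
      rw [hj, Submodule.mkQ_apply, Submodule.Quotient.mk_eq_zero, h.coe_mem_inflate]
    let ι : (T ⧸ m) →ₗ[T] A ⧸ h.inflate m := m.liftQ j fun t ht => (hker t).2 ht
    refine ⟨ι, ?_, ?_, fun t x => map_smul ι t x⟩
    · refine (injective_iff_map_eq_zero ι).2 fun x hx => ?_
      obtain ⟨t, rfl⟩ := m.mkQ_surjective x
      exact (Submodule.Quotient.mk_eq_zero _).2 ((hker t).1 hx)
    · ext y
      constructor
      · rintro ⟨x, rfl⟩
        obtain ⟨t, rfl⟩ := m.mkQ_surjective x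
        exact ⟨t, h.T_deg0 t.2, (hj t).symm⟩
      · rintro ⟨x, hx, rfl⟩
        obtain ⟨t, ht⟩ := h.exists_sub_mem_inflate m hx
        exact ⟨m.mkQ t, (hj t).trans ((Submodule.Quotient.eq _).2 ht).symm⟩

include h in
theorem nontrivial_of_isProperStandardFor {M : Type u} [AddCommGroup M] [Module T M]
    [IsSimpleModule T M] {D : Type u} [AddCommGroup D] [Module A D] {ι : M →+ D}
    (hD : IsProperStandardFor K A 𝒜 T Ap M D ι) : Nontrivial D := by
  obtain ⟨m, hm, ⟨e⟩⟩ := isSimpleModule_iff_quot_maximal.1 (inferInstance : IsSimpleModule T M)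
  obtain ⟨hgr, -, -, hpos, ι', hι', hr, hlin⟩ :=
    h.isLModule_inflate (m := m) (Ideal.isMaximal_def.1 hm)
  obtain ⟨F, hF, -⟩ := hD.2.2 (A ⧸ h.inflate m) (ι'.comp e.toLinearMap.toAddMonoidHom)
    (fun t x => by
      change ι' (e (t • x)) = _
      rw [map_smul]
      exact hlin t (e x))
    (fun a ha x => by
      refine Jpos_smul_eq_zero (fun j hj b hb => ?_) a ha
      have hmem : ι' (e x) ∈ quotGrading 𝒜 (h.inflate m) 0 := hr.subset (Set.mem_range_self _)
      have := hgr.2 _ _ _ _ hb hmem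
      rw [add_zero, hpos j hj] at this
      exact this)
  obtain ⟨x, hx⟩ := @exists_ne _ (IsSimpleModule.nontrivial T M) 0
  refine ⟨ι x, 0, fun h0 => hx ?_⟩
  have h1 : ι' (e x) = 0 := by
    have := hF x
    rw [h0, map_zero] at this
    exact this.symm
  exact e.map_eq_zero_iff.1 (hι' (h1.trans (map_zero ι').symm))

end TriangularDecomposition

end SimpleModules

section StandardFiltration

variable {𝒜 : ℤ → Submodule K A} {Am T Ap : Subalgebra K A}

variable {S : Type u} [AddCommGroup S] [Module A S] [Module K S] [IsScalarTower K A S]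
  {𝒮 : ℤ → Submodule K S} {P : Type u} [AddCommGroup P] [Module A P] [Module K P]
  [IsScalarTower K A P] {𝒬 : ℤ → Submodule K P} {φ : P →ₗ[A] S}

theorem IsGradedProjectiveCover.exists_isTop [FiniteDimensional K A]
    (h : TriangularDecomposition K A 𝒜 Am T Ap) (hT : IsSemisimpleRing T)
    (hself : Module.Injective A A) [IsSimpleModule A S]
    (hP : IsGradedProjectiveCover K A 𝒜 S 𝒮 P 𝒬 φ) :
    ∃ e : ℤ, IsSimpleModule T (h.piece hP.1 e) ∧ IsTop T 𝒬 (h.piece hP.1 e) e := by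
  have := hP.2.2.1
  have : FiniteDimensional K P := Module.Finite.trans A P
  have hfin := finite_degrees hP.1.1
  have hne : {i | 𝒬 i ≠ ⊥}.Nonempty := by
    obtain ⟨s, hs⟩ := @exists_ne _ (IsSimpleModule.nontrivial A S) 0
    obtain ⟨x, rfl⟩ := hP.2.2.2.1 s
    by_contra hemp
    rw [Set.not_nonempty_iff_eq_empty] at hemp
    refine hs ?_
    have : x = 0 := gproj_ext hP.1.1 fun i => by
      have hi : 𝒬 i = ⊥ := by
        by_contra hi
        exact (hemp.le hi : i ∈ (∅ : Set ℤ))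
      have := gproj_mem hP.1.1 i x
      rw [hi, Submodule.mem_bot] at this
      rw [this, map_zero]
    rw [this, map_zero]
  obtain ⟨e, he, hmax⟩ := hfin.exists_maximal hne
  have htop (i : ℤ) (hi : e < i) : 𝒬 i = ⊥ := by
    by_contra hne
    exact absurd (hmax (y := i) hne hi.le) (not_le.2 hi)
  exact ⟨e, hP.isSimpleModule_piece h hT hself htop he, htop, (h.piece hP.1 e).subtype,
    Subtype.val_injective, Subtype.range_coe⟩

theorem IsProperStandardFor.span_eq_top {M : Type u} [AddCommGroup M] [Module T M] {D : Type u}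
    [AddCommGroup D] [Module A D] {ι : M →+ D} (hD : IsProperStandardFor K A 𝒜 T Ap M D ι) :
    Submodule.span A (Set.range ι) = ⊤ := by
  obtain ⟨F, -, hF⟩ := hD.2.2 (D ⧸ Submodule.span A (Set.range ι)) 0
    (fun t m => (smul_zero _).symm) (fun a _ m => smul_zero a)
  have h1 := hF 0 fun m => rfl
  have h2 := hF (Submodule.mkQ _) fun m =>
    (Submodule.Quotient.mk_eq_zero _).2 (Submodule.subset_span ⟨m, rfl⟩)
  rw [← Submodule.ker_mkQ (Submodule.span A (Set.range ι)), h2, ← h1, LinearMap.ker_zero]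

theorem IsProperStandardFor.posIdeal_smul {M : Type u} [AddCommGroup M] [Module T M] {D : Type u}
    [AddCommGroup D] [Module A D] {ι : M →+ D} (hD : IsProperStandardFor K A 𝒜 T Ap M D ι) (m : M) :
    ∀ a ∈ posIdeal 𝒜 Ap, a • ι m = 0 :=
  posIdeal_smul_eq_zero fun b hb _ hj hbj => hD.2.1 b (mem_Jpos hb hj hbj) m

theorem IsProperStandardFor.congr {M M' : Type u} [AddCommGroup M] [Module T M] [AddCommGroup M']
    [Module T M'] {D : Type u} [AddCommGroup D] [Module A D] {ι : M →+ D}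
    (hD : IsProperStandardFor K A 𝒜 T Ap M D ι) (e : M' ≃ₗ[T] M) :
    IsProperStandardFor K A 𝒜 T Ap M' D (ι.comp e.toLinearMap.toAddMonoidHom) := by
  refine ⟨fun t m => ?_, fun a ha m => hD.2.1 a ha (e m), fun N _ _ f hf hf' => ?_⟩
  · change ι (e (t • m)) = _
    rw [map_smul]
    exact hD.1 t (e m)
  · obtain ⟨F, hF, huniq⟩ := hD.2.2 N (f.comp e.symm.toLinearMap.toAddMonoidHom)
      (fun t m => by
        change f (e.symm (t • m)) = _
        rw [map_smul]
        exact hf t (e.symm m))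
      (fun a ha m => hf' a ha (e.symm m))
    refine ⟨F, fun m => (hF (e m)).trans (congrArg f (e.symm_apply_apply m)), fun G hG => ?_⟩
    exact huniq G fun m => (congrArg (fun x => G (ι x)) (e.apply_symm_apply m)).symm.trans
      (hG (e.symm m))

/-- If the top component of `P` is simple and maps injectively to a factor of `P` which is a
standard module, then it is the head of that standard module. -/
theorem IsTop.exists_equiv_of_isProperStandardFor (h : TriangularDecomposition K A 𝒜 Am T Ap)
    (hQ : IsModuleGrading K A 𝒜 𝒬) {M : Type u} [AddCommGroup M] [Module T M] [IsSimpleModule T M]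
    {d' : ℤ} (ht : IsTop T 𝒬 M d') {R Q : Submodule A P} (hR : ∀ x ∈ R, ∀ i, gproj hQ.1 i x ∈ R)
    (hup : ∀ x ∈ 𝒬 d', x ∈ Q) (hdown : ∀ x ∈ 𝒬 d', x ∈ R → x = 0) {d : ℤ} {N : Type u}
    [AddCommGroup N] [Module T N] [IsSimpleModule T N]
    {ι : N →+ (↥Q ⧸ Submodule.comap Q.subtype R)}
    (hD : IsProperStandardFor K A 𝒜 T Ap N _ ι) (hι : ∀ n, ι n ∈ factorPiece K A 𝒬 R Q d) :
    d = d' ∧ ∃ e : M ≃ₗ[T] N, ∃ f : M →ₗ[T] P, Set.range f = (𝒬 d' : Set P) ∧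
      ∀ (m : M) (hm : f m ∈ Q), (Submodule.comap Q.subtype R).mkQ ⟨f m, hm⟩ = ι (e m) := by
  set q := (Submodule.comap Q.subtype R).mkQ with hq
  have hq0 (x : Q) : q x = 0 ↔ (x : P) ∈ R := by
    rw [hq, Submodule.mkQ_apply, Submodule.Quotient.mk_eq_zero]
    rfl
  choose y hy hyι using hι
  have key (x : P) (hx : x ∈ 𝒬 d') :
      ∃ a : N →₀ A, x = ∑ n ∈ a.support, gproj h.internal (d' - d) (a n) • (y n : P) := by
    have hmem : q ⟨x, hup x hx⟩ ∈ Submodule.span A (Set.range ι) :=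
      hD.span_eq_top ▸ Submodule.mem_top
    obtain ⟨a, ha⟩ := Finsupp.mem_span_range_iff_exists_finsupp.1 hmem
    refine ⟨a, ?_⟩
    have hsub : x - ∑ n ∈ a.support, a n • (y n : P) ∈ R := by
      have h1 : q (⟨x, hup x hx⟩ - ∑ n ∈ a.support, a n • y n) = 0 := by
        rw [map_sub, map_sum, ← ha, Finsupp.sum, sub_eq_zero]
        exact Finset.sum_congr rfl fun n _ => by rw [map_smul, hyι]
      have h2 := (hq0 _).1 h1
      rwa [Submodule.coe_sub, Submodule.coe_sum] at h2
    have h3 := hdown _ (gproj_mem hQ.1 d' _) (hR _ hsub d')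
    rw [map_sub, gproj_of_mem _ hx, map_sum, sub_eq_zero] at h3
    exact h3.trans (Finset.sum_congr rfl fun n _ => gproj_smul_of_mem h.internal hQ (hy n) d' (a n))
  obtain ⟨x, hx, hx0⟩ := ht.exists_ne_zero
  have hx' : q ⟨x, hup x hx⟩ ≠ 0 := fun h0 => hx0 (hdown x hx ((hq0 _).1 h0))
  obtain ⟨a, ha⟩ := key x hx
  have hle : d' ≤ d := by
    by_contra hlt
    refine hx' ?_
    have : (⟨x, hup x hx⟩ : Q) = ∑ n ∈ a.support, gproj h.internal (d' - d) (a n) • y n :=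
      Subtype.ext (by rw [Submodule.coe_sum]; exact ha)
    rw [this, map_sum]
    refine Finset.sum_eq_zero fun n _ => ?_
    rw [map_smul, hyι]
    exact hD.posIdeal_smul n _ (h.gproj_mem_posIdeal_of_pos _ (by omega))
  have hge : d ≤ d' := by
    by_contra hlt
    refine hx0 (ha.trans (Finset.sum_eq_zero fun n _ => ?_))
    have := hy n
    rw [Set.mem_ofPred_eq, ht.1 d (not_le.1 hlt), Submodule.mem_bot] at this
    rw [this, smul_zero]
  obtain rfl : d = d' := le_antisymm hge hle
  refine ⟨rfl, ?_⟩
  obtain ⟨-, f, hf, hfr⟩ := ht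
  have hfm (m : M) : f m ∈ 𝒬 d := hfr.subset (Set.mem_range_self m)
  let ιT : N →ₗ[T] (↥Q ⧸ Submodule.comap Q.subtype R) :=
    { toFun := ι
      map_add' := map_add ι
      map_smul' := hD.1 }
  let π : M →ₗ[T] (↥Q ⧸ Submodule.comap Q.subtype R) :=
    { toFun := fun m => q ⟨f m, hup _ (hfm m)⟩
      map_add' := fun m m' => by
        rw [← map_add]
        exact congrArg q (Subtype.ext (map_add f m m'))
      map_smul' := fun t m => by
        change q _ = (t : A) • q _
        rw [← map_smul]
        exact congrArg q (Subtype.ext (map_smul f t m)) }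
  have hπ : Function.Injective π := by
    refine (injective_iff_map_eq_zero π).2 fun m hm => hf ?_
    rw [hdown _ (hfm m) ((hq0 _).1 hm), map_zero]
  have hιT : Function.Injective ιT := by
    refine (LinearMap.injective_or_eq_zero ιT).resolve_right fun h0 => ?_
    refine hx0 (hdown x hx ((hq0 ⟨x, hup x hx⟩).1 ?_))
    have h1 := hD.span_eq_top.ge (Submodule.mem_top (x := q ⟨x, hup x hx⟩))
    have h2 : Set.range ι ⊆ {0} := by
      rintro _ ⟨n, rfl⟩
      exact LinearMap.congr_fun h0 n
    exact (Submodule.mem_bot A).1 (Submodule.span_le.2 h2 h1 : _ ∈ (⊥ : Submodule A _))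
  have hrange : LinearMap.range π = LinearMap.range ιT := by
    apply le_antisymm
    · rintro _ ⟨m, rfl⟩
      obtain ⟨a, ha⟩ := key (f m) (hfm m)
      have h1 : (⟨f m, hup _ (hfm m)⟩ : Q) =
          ∑ n ∈ a.support, gproj h.internal (d - d) (a n) • y n :=
        Subtype.ext (by rw [Submodule.coe_sum]; exact ha)
      change q ⟨f m, _⟩ ∈ _
      rw [h1, map_sum]
      refine sum_mem fun n _ => ?_
      rw [map_smul, hyι, sub_self]
      obtain ⟨t, ht, hat⟩ := h.exists_T_sub_mem_posIdeal (a n)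
      have h2 := hD.posIdeal_smul n _ hat
      rw [sub_smul, sub_eq_zero] at h2
      rw [h2]
      exact ⟨(⟨t, ht⟩ : T) • n, hD.1 ⟨t, ht⟩ n⟩
    · rintro _ ⟨n, rfl⟩
      obtain ⟨m, hm⟩ := hfr.superset (hy n)
      refine ⟨m, ?_⟩
      change q ⟨f m, _⟩ = ι n
      rw [← hyι n]
      exact congrArg q (Subtype.ext hm)
  let e := LinearEquiv.ofInjective π hπ ≪≫ₗ LinearEquiv.ofEq _ _ hrange ≪≫ₗ
    (LinearEquiv.ofInjective ιT hιT).symm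
  refine ⟨e, f, hfr, fun m hm => ?_⟩
  have h1 : LinearEquiv.ofInjective ιT hιT (e m) =
      LinearEquiv.ofEq _ _ hrange (LinearEquiv.ofInjective π hπ m) :=
    LinearEquiv.apply_symm_apply _ _
  exact (congrArg Subtype.val h1).symm

theorem IsGradedProjectiveCover.exists_standard_bottom [FiniteDimensional K A]
    (h : TriangularDecomposition K A 𝒜 Am T Ap) (hself : Module.Injective A A)
    [IsSimpleModule A S] (hP : IsGradedProjectiveCover K A 𝒜 S 𝒮 P 𝒬 φ) {M : Type u}
    [AddCommGroup M] [Module T M] [IsSimpleModule T M] {d' : ℤ} (ht : IsTop T 𝒬 M d') {n : ℕ}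
    {F : Fin (n + 1) → Submodule A P} (hF : IsStandardFiltration K A 𝒜 T Ap 𝒬 n F) (hn : 0 < n) :
    ∃ ι : M →+ (↥(F (⟨0, hn⟩ : Fin n).succ) ⧸ Submodule.comap (F (⟨0, hn⟩ : Fin n).succ).subtype
        (F (⟨0, hn⟩ : Fin n).castSucc)),
      IsProperStandardFor K A 𝒜 T Ap M _ ι ∧
      ∀ m : M, ι m ∈ factorPiece K A 𝒬 (F (⟨0, hn⟩ : Fin n).castSucc)
        (F (⟨0, hn⟩ : Fin n).succ) d' := by
  have : IsNoetherianRing A := isNoetherian_of_tower K inferInstance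
  obtain ⟨hmono, h0, hlast, hgr, hfac⟩ := hF
  obtain ⟨x, hx, hx0⟩ := ht.exists_ne_zero
  obtain ⟨k, hk, hk'⟩ := exists_jump h0 hlast hx0
  have hjump := ht.mem_of_jump (R := F k.castSucc) (Q := F k.succ) fun hsub =>
    hk' (factorPiece_subset_zero_iff.1 hsub x hx hk)
  obtain ⟨d, N, _, _, hN, ι, hD, hι⟩ := hfac k
  obtain ⟨rfl, e, f, hfr, hfe⟩ := ht.exists_equiv_of_isProperStandardFor h hP.1
    ((isGradedSubmodule'_iff h.internal hP.1).1 (hgr _)) hjump.1 hjump.2 hD hι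
  have hfm (m : M) : f m ∈ 𝒬 d := hfr.subset (Set.mem_range_self m)
  have hbot : F k.castSucc = ⊥ := by
    obtain ⟨G, hG, -⟩ := (hD.congr e).2.2 P f.toAddMonoidHom (fun t m => map_smul f t m)
      (fun a ha m => by
        refine Jpos_smul_eq_zero (fun j hj b hb => ?_) a ha
        have := hP.1.2 _ _ _ _ hb (hfm m)
        rwa [ht.1 _ (by omega), Submodule.mem_bot] at this)
    obtain ⟨u, hu⟩ := (hP.injective hself).out (F k.succ).subtype Subtype.val_injective
      (G ∘ₗ Submodule.mkQ _)
    rw [Submodule.eq_bot_iff]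
    intro z hz
    by_contra hz0
    obtain ⟨m, rfl⟩ := hfr.superset hx
    refine hP.false_of_fixed_of_killed (u := u) hz0 ?_ hx0 ?_
    · refine (hu ⟨z, hmono (Fin.castSucc_lt_succ).le hz⟩).trans ?_
      exact (congrArg G ((Submodule.Quotient.mk_eq_zero _).2 hz)).trans (map_zero G)
    · refine (hu ⟨f m, hk⟩).trans ?_
      rw [LinearMap.comp_apply, hfe]
      exact hG m
  have hk0 : k = ⟨0, hn⟩ := by
    by_contra hne
    obtain ⟨d₀, N₀, _, _, hN₀, ι₀, hD₀, -⟩ := hfac ⟨0, hn⟩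
    obtain ⟨z, hz⟩ := @exists_ne _ (h.nontrivial_of_isProperStandardFor hD₀) 0
    obtain ⟨w, rfl⟩ := Submodule.mkQ_surjective _ z
    have hlt : (⟨0, hn⟩ : Fin n).succ ≤ k.castSucc := by
      rw [Fin.succ_le_castSucc_iff, Fin.lt_def]
      exact Nat.pos_of_ne_zero fun h0 => hne (Fin.ext h0)
    have hw := hmono hlt w.2
    rw [hbot, Submodule.mem_bot] at hw
    refine hz ?_
    rw [show w = 0 from Subtype.ext hw, map_zero]
  subst hk0
  exact ⟨_, hD.congr e, fun m => hι (e m)⟩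

end StandardFiltration

section Uniqueness

variable {𝒜 : ℤ → Submodule K A} {Am T Ap : Subalgebra K A}

variable {P : Type u} [AddCommGroup P] [Module A P] [Module K P] [IsScalarTower K A P]
  {𝒬 : ℤ → Submodule K P} {P₂ : Type u} [AddCommGroup P₂] [Module A P₂] [Module K P₂]
  [IsScalarTower K A P₂] {𝒬₂ : ℤ → Submodule K P₂}

theorem IsTop.nonempty_equiv_piece (h : TriangularDecomposition K A 𝒜 Am T Ap)
    (hQ : IsModuleGrading K A 𝒜 𝒬) {M : Type u} [AddCommGroup M] [Module T M] {e : ℤ}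
    (ht : IsTop T 𝒬 M e) : Nonempty (M ≃ₗ[T] h.piece hQ e) := by
  obtain ⟨-, ι, hι, hr⟩ := ht
  refine ⟨LinearEquiv.ofInjective ι hι ≪≫ₗ LinearEquiv.ofEq _ _ (SetLike.coe_injective ?_)⟩
  rw [LinearMap.coe_range]
  exact hr

omit [IsScalarTower K A P] in
theorem IsTop.unique {M : Type u} [AddCommGroup M] [Module T M] [IsSimpleModule T M] {e : ℤ}
    (ht : IsTop T 𝒬 M e) {M₂ : Type u} [AddCommGroup M₂] [Module T M₂] [IsSimpleModule T M₂]
    {e₂ : ℤ} (ht₂ : IsTop T 𝒬 M₂ e₂) : e = e₂ ∧ Nonempty (M ≃ₗ[T] M₂) := by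
  obtain rfl : e = e₂ := by
    obtain ⟨x, hx, hx0⟩ := ht.exists_ne_zero
    obtain ⟨y, hy, hy0⟩ := ht₂.exists_ne_zero
    refine le_antisymm ?_ ?_
    · by_contra hlt
      rw [ht₂.1 _ (not_le.1 hlt)] at hx
      exact hx0 hx
    · by_contra hlt
      rw [ht.1 _ (not_le.1 hlt)] at hy
      exact hy0 hy
  obtain ⟨-, ι, hι, hr⟩ := ht
  obtain ⟨-, ι₂, hι₂, hr₂⟩ := ht₂
  exact ⟨rfl, ⟨LinearEquiv.ofInjective ι hι ≪≫ₗ LinearEquiv.ofEq _ _ (SetLike.coe_injective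
    (by rw [LinearMap.coe_range, LinearMap.coe_range, hr, hr₂])) ≪≫ₗ
    (LinearEquiv.ofInjective ι₂ hι₂).symm⟩⟩

omit [IsScalarTower K A P] in
theorem IsTop.congr {M : Type u} [AddCommGroup M] [Module T M] {e : ℤ}
    (ht : IsTop T 𝒬 M e) {M₂ : Type u} [AddCommGroup M₂] [Module T M₂] (f : M₂ ≃ₗ[T] M) :
    IsTop T 𝒬 M₂ e := by
  obtain ⟨h1, ι, hι, hr⟩ := ht
  refine ⟨h1, ι ∘ₗ f.toLinearMap, hι.comp f.injective, ?_⟩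
  rw [LinearMap.coe_comp, LinearEquiv.coe_coe, f.surjective.range_comp, hr]

omit [IsScalarTower K A P] [IsScalarTower K A P₂] in
theorem IsTop.map {M : Type u} [AddCommGroup M] [Module T M] {e : ℤ}
    (ht : IsTop T 𝒬 M e) {g : P →ₗ[A] P₂} (hg : Function.Injective g)
    (hgr : ∀ i, g '' (𝒬 i) = (𝒬₂ i : Set P₂)) : IsTop T 𝒬₂ M e := by
  obtain ⟨h1, ι, hι, hr⟩ := ht
  refine ⟨fun i hi => SetLike.coe_injective ?_, g.restrictScalars T ∘ₗ ι, hg.comp hι, ?_⟩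
  · rw [← hgr, h1 i hi]
    simp
  · rw [LinearMap.coe_comp, Set.range_comp, hr]
    exact hgr e

theorem IsLModule.isTop {M : Type u} [AddCommGroup M] [Module T M] {e : ℤ}
    (hP : IsLModule K A 𝒜 T e M P 𝒬) : IsTop T 𝒬 M e := by
  obtain ⟨-, -, -, h1, ι, hι, hr, hlin⟩ := hP
  exact ⟨h1, { ι with map_smul' := hlin }, hι, hr⟩

theorem TriangularDecomposition.exists_graded_extension (h : TriangularDecomposition K A 𝒜 Am T Ap)
    (hQ : IsModuleGrading K A 𝒜 𝒬) (hQ₂ : IsModuleGrading K A 𝒜 𝒬₂) [Module.Projective A P]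
    (hP₂ : Module.Injective A P₂) {e : ℤ} (he : ∀ i, e < i → 𝒬 i = ⊥) (he₂ : ∀ i, e < i → 𝒬₂ i = ⊥)
    (θ : h.piece hQ e →ₗ[T] h.piece hQ₂ e) :
    ∃ g : P →ₗ[A] P₂, (∀ i, ∀ x ∈ 𝒬 i, g x ∈ 𝒬₂ i) ∧
      ∀ x : h.piece hQ e, g x = (θ x : P₂) := by
  obtain ⟨g, hg⟩ := h.exists_extension hQ he hP₂ ((h.piece hQ₂ e).subtype ∘ₗ θ)
    fun x a ha => posIdeal_smul_top hQ₂ he₂ (θ x).2 a ha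
  obtain ⟨g₀, hg₀⟩ := exists_degree_zero_component h.internal hQ hQ₂ g
  refine ⟨g₀, fun i x hx => ?_, fun x => ?_⟩
  · rw [hg₀ i x hx]
    exact gproj_mem _ _ _
  · rw [hg₀ e x x.2, hg]
    exact gproj_of_mem _ (θ x).2

theorem injective_of_fixed [IsNoetherianRing A] {S : Type u} [AddCommGroup S] [Module A S]
    [Module K S] [IsScalarTower K A S] [IsSimpleModule A S] {𝒮 : ℤ → Submodule K S}
    {φ : P →ₗ[A] S} (hP : IsGradedProjectiveCover K A 𝒜 S 𝒮 P 𝒬 φ) {u : P →ₗ[A] P} {y : P}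
    (hy : y ≠ 0) (huy : u y = y) : Function.Injective u := by
  refine (injective_iff_map_eq_zero u).2 fun x hx => ?_
  by_contra hx0
  exact hP.false_of_fixed_of_killed hx0 hx hy huy

theorem IsGradedProjectiveCover.image_eq {S : Type u} [AddCommGroup S] [Module A S]
    [Module K S] [IsScalarTower K A S] {𝒮 : ℤ → Submodule K S} (hS : DirectSum.IsInternal 𝒮)
    {φ : P →ₗ[A] S} (hP : IsGradedProjectiveCover K A 𝒜 S 𝒮 P 𝒬 φ) (i : ℤ) :
    φ '' (𝒬 i) = (𝒮 i : Set S) := by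
  refine (hP.2.2.2.2.1 i).antisymm fun s hs => ?_
  obtain ⟨x, rfl⟩ := hP.2.2.2.1 s
  refine ⟨gproj hP.1.1 i x, gproj_mem _ i x, ?_⟩
  rw [← gproj_map hP.1.1 hS φ fun i x hx => hP.2.2.2.2.1 i ⟨x, hx, rfl⟩]
  exact gproj_of_mem hS hs

/-- A projective cover of a simple graded module is determined by its highest weight. -/
theorem IsGradedProjectiveCover.eq_of_isTop [FiniteDimensional K A]
    (h : TriangularDecomposition K A 𝒜 Am T Ap) (hself : Module.Injective A A)
    {S : Type u} [AddCommGroup S] [Module A S] [Module K S] [IsScalarTower K A S]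
    {𝒮 : ℤ → Submodule K S} {S₂ : Type u} [AddCommGroup S₂] [Module A S₂] [Module K S₂]
    [IsScalarTower K A S₂] {𝒮₂ : ℤ → Submodule K S₂} {φ : P →ₗ[A] S} {φ₂ : P₂ →ₗ[A] S₂}
    (hP : IsGradedProjectiveCover K A 𝒜 S 𝒮 P 𝒬 φ)
    (hP₂ : IsGradedProjectiveCover K A 𝒜 S₂ 𝒮₂ P₂ 𝒬₂ φ₂)
    {Ml : Type u} [AddCommGroup Ml] [Module T Ml] [IsSimpleModule T Ml] {d : ℤ}
    (hS : IsLModule K A 𝒜 T d Ml S 𝒮)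
    {Ml₂ : Type u} [AddCommGroup Ml₂] [Module T Ml₂] [IsSimpleModule T Ml₂] {d₂ : ℤ}
    (hS₂ : IsLModule K A 𝒜 T d₂ Ml₂ S₂ 𝒮₂)
    {M : Type u} [AddCommGroup M] [Module T M] [IsSimpleModule T M] {e : ℤ}
    (ht : IsTop T 𝒬 M e) (ht₂ : IsTop T 𝒬₂ M e) : d = d₂ ∧ Nonempty (Ml ≃ₗ[T] Ml₂) := by
  have : IsNoetherianRing A := isNoetherian_of_tower K inferInstance
  have : IsArtinianRing A := isArtinian_of_tower K inferInstance
  have := hS.isSimpleModule h.internal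
  have := hS₂.isSimpleModule h.internal
  have := hP.2.1
  have := hP₂.2.1
  have := hP.2.2.1
  have := hP₂.2.2.1
  obtain ⟨ε⟩ := ht.nonempty_equiv_piece h hP.1
  obtain ⟨ε₂⟩ := ht₂.nonempty_equiv_piece h hP₂.1
  let θ := ε.symm ≪≫ₗ ε₂
  obtain ⟨g, hg, hgθ⟩ := h.exists_graded_extension hP.1 hP₂.1 (hP₂.injective hself) ht.1 ht₂.1
    θ.toLinearMap
  obtain ⟨g', hg', hgθ'⟩ := h.exists_graded_extension hP₂.1 hP.1 (hP.injective hself) ht₂.1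
    ht.1 θ.symm.toLinearMap
  obtain ⟨x, hx, hx0⟩ := ht.exists_ne_zero
  obtain ⟨y, hy, hy0⟩ := ht₂.exists_ne_zero
  have hinj : Function.Injective (g' ∘ₗ g) := injective_of_fixed hP hx0 (by
    have h1 := hgθ ⟨x, hx⟩
    have h2 := hgθ' (θ ⟨x, hx⟩)
    rw [LinearEquiv.coe_coe, LinearEquiv.symm_apply_apply] at h2
    rw [LinearMap.comp_apply]
    exact (congrArg g' h1).trans h2)
  have hinj' : Function.Injective (g ∘ₗ g') := injective_of_fixed hP₂ hy0 (by
    have h1 := hgθ' ⟨y, hy⟩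
    have h2 := hgθ (θ.symm ⟨y, hy⟩)
    rw [LinearEquiv.coe_coe, LinearEquiv.apply_symm_apply] at h2
    rw [LinearMap.comp_apply]
    exact (congrArg g h1).trans h2)
  have hsurj : Function.Surjective g :=
    Function.Surjective.of_comp (g := g')
      (IsArtinian.surjective_of_injective_endomorphism _ hinj')
  have hginj : Function.Injective g := Function.Injective.of_comp (f := g') hinj
  have hcomp : Function.Surjective (φ₂ ∘ₗ g) := hP₂.2.2.2.1.comp hsurj
  have hcoatom : IsCoatom (LinearMap.ker (φ₂ ∘ₗ g)) :=
    LinearMap.isCoatom_ker_of_surjective hcomp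
  have hker : LinearMap.ker φ ≤ LinearMap.ker (φ₂ ∘ₗ g) := by
    by_contra hle
    exact hcoatom.1 (hP.2.2.2.2.2 _ (hcoatom.2 _ (left_lt_sup.2 hle)))
  let ψ : S →ₗ[A] S₂ := (LinearMap.ker φ).liftQ (φ₂ ∘ₗ g) hker ∘ₗ
    (φ.quotKerEquivOfSurjective hP.2.2.2.1).symm.toLinearMap
  have hψ (z : P) : ψ (φ z) = φ₂ (g z) := by
    have : (φ.quotKerEquivOfSurjective hP.2.2.2.1).symm (φ z) = (LinearMap.ker φ).mkQ z :=
      (LinearEquiv.symm_apply_eq _).2 rfl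
    change (LinearMap.ker φ).liftQ (φ₂ ∘ₗ g) hker
      ((φ.quotKerEquivOfSurjective hP.2.2.2.1).symm (φ z)) = _
    rw [this]
    rfl
  have hψinj : Function.Injective ψ := by
    refine (LinearMap.injective_or_eq_zero ψ).resolve_right fun h0 => ?_
    obtain ⟨s, hs⟩ := @exists_ne _ (IsSimpleModule.nontrivial A S₂) 0
    obtain ⟨z, rfl⟩ := hcomp s
    exact hs ((hψ z).symm.trans (LinearMap.congr_fun h0 _))
  have hgimage (i : ℤ) : g '' (𝒬 i) = (𝒬₂ i : Set P₂) := by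
    refine Set.Subset.antisymm (Set.image_subset_iff.2 (hg i)) fun z hz => ?_
    obtain ⟨w, rfl⟩ := hsurj z
    refine ⟨gproj hP.1.1 i w, gproj_mem _ i w, ?_⟩
    rw [← gproj_map hP.1.1 hP₂.1.1 g hg]
    exact gproj_of_mem _ hz
  have hψimage (i : ℤ) : ψ '' (𝒮 i) = (𝒮₂ i : Set S₂) := by
    rw [← hP.image_eq hS.1.1, ← hP₂.image_eq hS₂.1.1, ← hgimage, Set.image_image, Set.image_image]
    simp only [hψ]
  exact (hS.isTop.map hψinj hψimage).unique hS₂.isTop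

end Uniqueness

theorem exists_isCoatom_ker_toSpanSingleton (R V : Type*) [Ring R] [AddCommGroup V] [Module R V]
    [IsSemisimpleModule R V] [Nontrivial V] :
    ∃ y : V, y ≠ 0 ∧ IsCoatom (LinearMap.ker (LinearMap.toSpanSingleton R V y)) := by
  obtain ⟨X, hX⟩ := IsSemisimpleModule.exists_simple_submodule R V
  have := IsSimpleModule.nontrivial R X
  obtain ⟨y, hy⟩ := exists_ne (0 : X)
  have hker : LinearMap.ker (LinearMap.toSpanSingleton R V (y : V)) =
      LinearMap.ker (LinearMap.toSpanSingleton R X y) := by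
    ext r
    simp [← Subtype.coe_inj]
  refine ⟨y, fun h0 => hy (Subtype.ext h0), ?_⟩
  rw [hker]
  exact LinearMap.isCoatom_ker_of_surjective (IsSimpleModule.toSpanSingleton_surjective R hy)

section Gradable

variable {𝒜 : ℤ → Submodule K A} {Am T Ap : Subalgebra K A}

namespace TriangularDecomposition

variable (h : TriangularDecomposition K A 𝒜 Am T Ap)

theorem ker_toSpanSingleton_le_inflate [FiniteDimensional K A] {S : Type u} [AddCommGroup S]
    [Module A S] {y : S} (hy0 : y ≠ 0) (hy : ∀ a ∈ posIdeal 𝒜 Ap, a • y = 0) {m : Submodule T T}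
    (hm : IsCoatom m) (hmy : ∀ t : T, t ∈ m ↔ (t : A) • y = 0) :
    LinearMap.ker (LinearMap.toSpanSingleton A S y) ≤ h.inflate m := by
  intro x hx a
  rw [LinearMap.mem_ker, LinearMap.toSpanSingleton_apply] at hx
  obtain ⟨w, hw, hwa⟩ := h.exists_degLE_neg_one (a * x)
  obtain ⟨t, ht, hta⟩ := h.exists_T_sub_mem_posIdeal (a * x)
  refine ⟨⟨t, ht⟩, ?_, hta⟩
  have h1 : t • y + w • y = 0 := by
    have h3 := hy _ (add_mem hwa hta)
    rw [show a * x - gproj h.internal 0 (a * x) - w + (gproj h.internal 0 (a * x) - t) =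
      a * x - (t + w) by abel, sub_smul, mul_smul, hx, smul_zero, zero_sub, neg_eq_zero,
      add_smul] at h3
    exact h3
  by_contra htm
  obtain ⟨s, i, hi, hsi⟩ := (Ideal.isMaximal_def.2 hm).exists_inv htm
  have h4 : (s : A) • t • y = y := by
    have h5 : ((s : A) * t + i) • y = y := by
      rw [show (s : A) * t + i = 1 from congrArg Subtype.val hsi, one_smul]
    rwa [add_smul, (hmy i).1 hi, add_zero, mul_smul] at h5
  have hsw : (s : A) * w ∈ degLE h.internal (-1) := by
    have := smul_mem_degLE h.internal h.isModuleGrading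
      (mem_degLE_of_mem h.internal le_rfl (h.T_deg0 s.2)) hw
    rwa [zero_add] at this
  obtain ⟨n, hn⟩ := h.exists_pow_eq_zero hsw
  have hunit : IsUnit (1 + (s : A) * w) := IsNilpotent.isUnit_one_add ⟨n, hn⟩
  refine hy0 ((hunit.smul_eq_zero).1 ?_)
  rw [add_smul, one_smul, mul_smul]
  nth_rewrite 1 [← h4]
  rw [← smul_add, h1, smul_zero]

include h in
theorem exists_killed_by_pos [FiniteDimensional K A] (S : Type u) [AddCommGroup S] [Module A S]
    [Nontrivial S] : ∃ y : S, y ≠ 0 ∧ ∀ j, 0 < j → ∀ a ∈ 𝒜 j, a • y = 0 := by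
  obtain ⟨s, hs⟩ := exists_ne (0 : S)
  have hfin : {n | ∃ a ∈ 𝒜 n, ∃ s : S, a • s ≠ 0}.Finite := by
    refine (finite_degrees h.internal).subset ?_
    rintro n ⟨a, ha, s, hs⟩ hn
    rw [hn, Submodule.mem_bot] at ha
    exact hs (by rw [ha, zero_smul])
  obtain ⟨n, ⟨b, hb, s, hbs⟩, hmax⟩ := hfin.exists_maximal
    ⟨0, 1, h.one_mem, s, by rwa [one_smul]⟩
  refine ⟨b • s, hbs, fun j hj a ha => ?_⟩
  by_contra hne
  rw [← mul_smul] at hne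
  have := hmax (y := j + n) ⟨a * b, h.mul_mem _ _ _ _ ha hb, s, hne⟩ (by omega)
  omega

/-- Every simple module is gradable. -/
theorem exists_equiv_inflate [FiniteDimensional K A] (hT : IsSemisimpleRing T) (S : Type u)
    [AddCommGroup S] [Module A S] [IsSimpleModule A S] :
    ∃ m : Submodule T T, IsCoatom m ∧ Nonempty (S ≃ₗ[A] A ⧸ h.inflate m) := by
  have := IsSimpleModule.nontrivial A S
  let V : Submodule T S :=
    { carrier := {y | ∀ j, 0 < j → ∀ a ∈ 𝒜 j, a • y = 0}
      zero_mem' := fun j _ a _ => smul_zero a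
      add_mem' := fun hx hy j hj a ha => by rw [smul_add, hx j hj a ha, hy j hj a ha, add_zero]
      smul_mem' := fun t x hx j hj a ha => by
        change a • (t : A) • x = 0
        rw [← mul_smul]
        refine hx j hj _ ?_
        have := h.mul_mem _ _ _ _ ha (h.T_deg0 t.2)
        rwa [add_zero] at this }
  obtain ⟨y₀, hy₀, hpos⟩ := h.exists_killed_by_pos S
  have : Nontrivial V := ⟨⟨y₀, hpos⟩, 0, fun h0 => hy₀ (congrArg Subtype.val h0)⟩
  obtain ⟨y, hy, hm⟩ := exists_isCoatom_ker_toSpanSingleton T V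
  have hcoe : (y : S) ≠ 0 := fun h0 => hy (Subtype.ext h0)
  have hle := h.ker_toSpanSingleton_le_inflate hcoe
    (posIdeal_smul_eq_zero fun b _ j hj hb => y.2 j hj b hb) hm fun t => by
      rw [LinearMap.mem_ker, LinearMap.toSpanSingleton_apply, ← Subtype.coe_inj]
      rfl
  have hsurj := IsSimpleModule.toSpanSingleton_surjective A hcoe
  have heq := ((LinearMap.isCoatom_ker_of_surjective hsurj).le_iff_eq
    fun htop => h.one_notMem_inflate hm.1 (htop.ge Submodule.mem_top)).1 hle
  exact ⟨_, hm, ⟨(LinearMap.quotKerEquivOfSurjective _ hsurj).symm ≪≫ₗ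
    Submodule.quotEquivOfEq _ _ heq.symm⟩⟩

end TriangularDecomposition

end Gradable

theorem exists_pow_mul_pow_mul_eq [FiniteDimensional K A] (y : A) :
    ∃ n : ℕ, ∃ w ∈ Algebra.adjoin K {y}, Commute y w ∧
      y ^ (n + 1) * y ^ (n + 1) * w = y ^ (n + 1) := by
  have : IsMulCommutative (Algebra.adjoin K {y}) := Algebra.isMulCommutative_adjoin K (by
    rintro a rfl b rfl
    rfl)
  have : IsArtinianRing (Algebra.adjoin K {y}) := isArtinian_of_tower K inferInstance
  let r : Algebra.adjoin K {y} := ⟨y, Algebra.self_mem_adjoin_singleton K y⟩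
  obtain ⟨n, z, hz⟩ := IsArtinian.exists_pow_succ_smul_dvd r (1 : Algebra.adjoin K {y})
  rw [smul_eq_mul, smul_eq_mul, mul_one, Nat.succ_eq_add_one] at hz
  have hk (k : ℕ) : r ^ (n + k) * z ^ k = r ^ n := by
    induction k with
    | zero => simp
    | succ k ih =>
      calc r ^ (n + (k + 1)) * z ^ (k + 1) = r ^ k * (r ^ (n + 1) * z) * z ^ k := by ring
        _ = r ^ (n + k) * z ^ k := by rw [hz]; ring
        _ = r ^ n := ih
  have h1 : r ^ (n + 1) * r ^ (n + 1) * z ^ (n + 1) = r ^ (n + 1) := by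
    calc r ^ (n + 1) * r ^ (n + 1) * z ^ (n + 1) = r * (r ^ (n + (n + 1)) * z ^ (n + 1)) := by ring
      _ = r ^ (n + 1) := by rw [hk]; ring
  exact ⟨n, (z ^ (n + 1) : Algebra.adjoin K {y}), Subtype.property _,
    congrArg Subtype.val (mul_comm r (z ^ (n + 1))), congrArg Subtype.val h1⟩

section Cover

variable {𝒜 : ℤ → Submodule K A} {Am T Ap : Subalgebra K A}

namespace TriangularDecomposition

variable (h : TriangularDecomposition K A 𝒜 Am T Ap)

include h in
theorem mul_mem_zero {a b : A} (ha : a ∈ 𝒜 0) (hb : b ∈ 𝒜 0) : a * b ∈ 𝒜 0 := by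
  have := h.mul_mem _ _ _ _ ha hb
  rwa [add_zero] at this

include h in
theorem adjoin_le_zero {y : A} (hy : y ∈ 𝒜 0) {w : A} (hw : w ∈ Algebra.adjoin K {y}) :
    w ∈ 𝒜 0 := by
  induction hw using Algebra.adjoin_induction with
  | mem x hx => rwa [Set.mem_singleton_iff.1 hx]
  | algebraMap r =>
    rw [Algebra.algebraMap_eq_smul_one]
    exact Submodule.smul_mem _ r h.one_mem
  | add _ _ _ _ h1 h2 => exact add_mem h1 h2
  | mul _ _ _ _ h1 h2 => exact h.mul_mem_zero h1 h2

/-- A primitive idempotent of degree `0` outside the maximal graded left ideal `inflate m`. -/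
theorem exists_primitive_idempotent [FiniteDimensional K A] {m : Submodule T T} (hm : IsCoatom m) :
    ∃ f ∈ 𝒜 0, f * f = f ∧ f ∉ h.inflate m ∧
      ∀ y ∈ 𝒜 0, f * y = y → y * f = y → y ∉ h.inflate m → ∃ b, b * y = f := by
  obtain ⟨f, ⟨hf0, hff, hfm⟩, hmin⟩ := (InvImage.wf (fun f : A =>
      Module.finrank K (Submodule.span A {f})) wellFounded_lt).has_min
    {f | f ∈ 𝒜 0 ∧ f * f = f ∧ f ∉ h.inflate m}
    ⟨1, h.one_mem, one_mul 1, h.one_notMem_inflate hm.1⟩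
  refine ⟨f, hf0, hff, hfm, fun y hy hfy hyf hym => ?_⟩
  obtain ⟨a, ha, hay⟩ := h.exists_mul_sub_one_mem_inflate hm hy hym
  rw [neg_zero] at ha
  have hy'0 : f * a * y ∈ 𝒜 0 := h.mul_mem_zero (h.mul_mem_zero hf0 ha) hy
  have hy'f : f * a * y * f = f * a * y := by rw [mul_assoc, hyf]
  have hsub : f * a * y - f ∈ h.inflate m := by
    have := (h.inflate m).smul_mem f hay
    rwa [smul_eq_mul, mul_sub, mul_one, ← mul_assoc] at this
  obtain ⟨n, w, hw, hcomm, hpow⟩ := exists_pow_mul_pow_mul_eq (K := K) (f * a * y)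
  set y' := f * a * y with hy'
  have hfpow (k : ℕ) : y' ^ (k + 1) - f ∈ h.inflate m := by
    induction k with
    | zero => rwa [zero_add, pow_one]
    | succ k ih =>
      have h1 := add_mem ((h.inflate m).smul_mem (y' ^ (k + 1)) hsub) ih
      rw [smul_eq_mul, mul_sub, ← pow_succ] at h1
      have h2 : y' ^ (k + 1) * f = y' ^ (k + 1) := by rw [pow_succ, mul_assoc, hy'f]
      rwa [h2, sub_add_sub_cancel] at h1
  have hpowm : y' ^ (n + 1) ∉ h.inflate m := fun hmem =>
    hfm (by simpa using sub_mem hmem (hfpow n))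
  have hc : w * y' ^ (n + 1) = y' ^ (n + 1) * w := (hcomm.pow_left (n + 1)).symm.eq
  have hpf : y' ^ (n + 1) * w * f = y' ^ (n + 1) * w := by
    rw [← hc, mul_assoc, pow_succ, mul_assoc, hy'f]
  have hle : Submodule.span A {y' ^ (n + 1) * w} ≤ Submodule.span A {f} := by
    rw [Submodule.span_singleton_le_iff_mem, Submodule.mem_span_singleton]
    exact ⟨_, hpf⟩
  have hge := hmin (y' ^ (n + 1) * w) ⟨h.mul_mem_zero (h.adjoin_le_zero hy'0
      (pow_mem (Algebra.self_mem_adjoin_singleton K y') _)) (h.adjoin_le_zero hy'0 hw), by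
        rw [← mul_assoc, mul_assoc _ w, hc, ← mul_assoc, hpow], fun hmem => hpowm (by
        have := (h.inflate m).smul_mem (y' ^ (n + 1)) hmem
        rwa [smul_eq_mul, ← mul_assoc, hpow] at this)⟩
  have heq := Submodule.eq_of_le_of_finrank_le 
    (S₁ := (Submodule.span A {y' ^ (n + 1) * w}).restrictScalars K)
    (S₂ := (Submodule.span A {f}).restrictScalars K) hle (not_lt.1 hge)
  have hfmem : f ∈ (Submodule.span A {y' ^ (n + 1) * w}).restrictScalars K :=
    heq.ge (Submodule.mem_span_singleton_self f)
  obtain ⟨v, hv⟩ := Submodule.mem_span_singleton.1 hfmem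
  refine ⟨v * w * y' ^ n * f * a, ?_⟩
  rw [smul_eq_mul, ← hc, pow_succ] at hv
  calc v * w * y' ^ n * f * a * y = v * (w * (y' ^ n * y')) := by simp only [hy', mul_assoc]
    _ = f := hv

theorem smul_eq_zero_of_mem_inflate {m : Submodule T T} {f : A} (hf0 : f ∈ 𝒜 0) (hff : f * f = f)
    (hfm : f ∉ h.inflate m)
    (hf : ∀ y ∈ 𝒜 0, f * y = y → y * f = y → y ∉ h.inflate m → ∃ b, b * y = f)
    {X : Type u} [AddCommGroup X] [Module A X] [Module K X] [IsScalarTower K A X]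
    [IsSimpleModule A X] {𝒳 : ℤ → Submodule K X} (hX : IsModuleGrading K A 𝒜 𝒳) {s : X}
    (hs : f • s = s) {x : A} (hx : x ∈ h.inflate m) (hxf : x * f = x) : x • s = 0 := by
  have hhom (i j : ℤ) (s : X) (hsi : s ∈ 𝒳 i) (hs : f • s = s) (x : A) (hxj : x ∈ 𝒜 j)
      (hx : x ∈ h.inflate m) (hxf : x * f = x) : x • s = 0 := by
    by_contra hne
    obtain ⟨b, hb⟩ := IsSimpleModule.toSpanSingleton_surjective A hne s
    rw [LinearMap.toSpanSingleton_apply] at hb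
    have hb' : gproj h.internal (-j) b • x • s = s := by
      have := gproj_smul_of_mem h.internal hX (hX.2 _ _ _ _ hxj hsi) i b
      rw [hb, gproj_of_mem hX.1 hsi, sub_add_cancel_right] at this
      exact this.symm
    set a := gproj h.internal (-j) b
    have hx₀0 : f * (a * x) ∈ 𝒜 0 := h.mul_mem_zero hf0 (by
      have := h.mul_mem _ _ _ _ (gproj_mem h.internal (-j) b) hxj
      rwa [neg_add_cancel] at this)
    have hx₀m : f * (a * x) ∈ h.inflate m :=
      (h.inflate m).smul_mem f ((h.inflate m).smul_mem a hx)
    have hx₀s : (f - f * (a * x)) • s = 0 := by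
      rw [sub_smul, hs, mul_smul, mul_smul, hb', hs, sub_self]
    obtain ⟨c, hc⟩ := hf (f - f * (a * x)) (sub_mem hf0 hx₀0)
      (by rw [mul_sub, hff, ← mul_assoc, hff])
      (by rw [sub_mul, hff, mul_assoc, mul_assoc, hxf])
      (fun hmem => hfm (by simpa using add_mem hmem hx₀m))
    refine hne ?_
    rw [← hs, ← hc, mul_smul, hx₀s, smul_zero, smul_zero]
  have hxi (i : ℤ) : gproj h.internal i x * f = gproj h.internal i x := by
    have := h.gproj_mul_right hf0 i x
    rw [hxf, sub_zero] at this
    exact this.symm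
  have hsi (i : ℤ) : f • gproj hX.1 i s = gproj hX.1 i s := by
    have := gproj_smul hX hf0 i s
    rw [hs, sub_zero] at this
    exact this.symm
  rw [eq_sum_gproj h.internal x, eq_sum_gproj hX.1 s, Finset.sum_smul]
  refine Finset.sum_eq_zero fun j _ => ?_
  rw [Finset.smul_sum]
  exact Finset.sum_eq_zero fun i _ => hhom i j _ (gproj_mem hX.1 i s) (hsi i) _
    (gproj_mem h.internal j x) (h.gproj_mem_inflate x hx j) (hxi j)

theorem exists_isGradedProjectiveCover [FiniteDimensional K A] (hT : IsSemisimpleRing T)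
    {m : Submodule T T} (hm : IsCoatom m) :
    ∃ (P : Type u) (_ : AddCommGroup P) (_ : Module A P) (_ : Module K P)
      (_ : IsScalarTower K A P) (𝒬 : ℤ → Submodule K P) (φ : P →ₗ[A] A ⧸ h.inflate m),
      IsGradedProjectiveCover K A 𝒜 (A ⧸ h.inflate m) (quotGrading 𝒜 (h.inflate m)) P 𝒬 φ := by
  have : IsNoetherianRing A := isNoetherian_of_tower K inferInstance
  obtain ⟨f, hf0, hff, hfm, hf⟩ := h.exists_primitive_idempotent hm
  have hfix (x : Submodule.span A {f}) : (x : A) * f = x := by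
    obtain ⟨c, hc⟩ := Submodule.mem_span_singleton.1 x.2
    rw [← hc, smul_eq_mul, mul_assoc, hff]
  have := isSimpleModule_iff_isCoatom.2 hm
  have hL := h.isLModule_inflate hm
  have hsimple := hL.isSimpleModule h.internal
  have hgr := isModuleGrading_sub h.isModuleGrading
    (span_singleton_gproj_mem h.internal h.isModuleGrading hf0)
  let e : Submodule.span A {f} := ⟨f, Submodule.mem_span_singleton_self f⟩
  have hmul (x : Submodule.span A {f}) : (x : A) • e = x := Subtype.ext (hfix x)
  let φ : Submodule.span A {f} →ₗ[A] A ⧸ h.inflate m :=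
    (h.inflate m).mkQ ∘ₗ (Submodule.span A {f}).subtype
  have hφ : Function.Surjective φ := by
    refine (LinearMap.surjective_or_eq_zero φ).resolve_right fun h0 => hfm ?_
    exact (Submodule.Quotient.mk_eq_zero _).1 (LinearMap.congr_fun h0 e)
  refine ⟨Submodule.span A {f}, inferInstance, inferInstance, inferInstance, inferInstance,
    subGrading 𝒜 _, φ, hgr, ?_, inferInstance, hφ, ?_, fun N hN => ?_⟩
  · exact Module.Projective.of_split (Submodule.span A {f}).subtype
      (LinearMap.toSpanSingleton A _ e) (LinearMap.ext hmul)
  · rintro i _ ⟨x, hx, rfl⟩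
    exact mk_mem_quotGrading hx
  · by_contra hne
    obtain ⟨N', hN', hle⟩ := (eq_top_or_exists_le_coatom N).resolve_left hne
    have := isSimpleModule_iff_isCoatom.2 hN'
    obtain ⟨m', hm', ⟨ε⟩⟩ := h.exists_equiv_inflate hT (Submodule.span A {f} ⧸ N')
    have := isSimpleModule_iff_isCoatom.2 hm'
    have hL' := h.isLModule_inflate hm'
    have := hL'.isSimpleModule h.internal
    have hs (x : Submodule.span A {f}) : (x : A) • ε (N'.mkQ e) = ε (N'.mkQ x) := by
      rw [← map_smul, ← map_smul, hmul]
    refine hN'.1 (eq_top_iff.2 (hN.ge.trans (sup_le hle fun x hx => ?_)))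
    have hxm : (x : A) ∈ h.inflate m := (Submodule.Quotient.mk_eq_zero _).1 hx
    have h0 := h.smul_eq_zero_of_mem_inflate hf0 hff hfm hf hL'.1 (hs e) hxm (hfix x)
    rw [hs, ε.map_eq_zero_iff] at h0
    exact (Submodule.Quotient.mk_eq_zero _).1 h0

end TriangularDecomposition

end Cover

section Shift

variable {𝒜 : ℤ → Submodule K A} {T : Subalgebra K A}
variable {P : Type u} [AddCommGroup P] [Module A P] [Module K P] [IsScalarTower K A P]
  {𝒬 : ℤ → Submodule K P} {S : Type u} [AddCommGroup S] [Module A S] [Module K S]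
  [IsScalarTower K A S] {𝒮 : ℤ → Submodule K S} {M : Type u} [AddCommGroup M] [Module T M]

omit [IsScalarTower K A P] in
theorem IsTop.shift {e : ℤ} (ht : IsTop T 𝒬 M e) (s : ℤ) :
    IsTop T (fun i => 𝒬 (i + s)) M (e - s) := by
  refine ⟨fun i hi => ht.1 _ (by omega), ?_⟩
  simpa only [sub_add_cancel] using ht.2

theorem IsLModule.shift {d : ℤ} (hS : IsLModule K A 𝒜 T d M S 𝒮) (s : ℤ) :
    IsLModule K A 𝒜 T (d - s) M S (fun i => 𝒮 (i + s)) := by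
  obtain ⟨hgr, hnt, hsimple, hd, hι⟩ := hS
  refine ⟨isModuleGrading_shift hgr s, hnt, fun N hN => hsimple N (hN.trans ?_),
    fun i hi => hd _ (by omega), ?_⟩
  · exact Submodule.span_mono (Set.iUnion_subset fun i =>
      Set.subset_iUnion (fun i => (N : Set S) ∩ 𝒮 i) (i + s))
  · simpa only [sub_add_cancel] using hι

theorem IsGradedProjectiveCover.shift {φ : P →ₗ[A] S}
    (hP : IsGradedProjectiveCover K A 𝒜 S 𝒮 P 𝒬 φ) (s : ℤ) :
    IsGradedProjectiveCover K A 𝒜 S (fun i => 𝒮 (i + s)) P (fun i => 𝒬 (i + s)) φ := by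
  obtain ⟨hgr, hproj, hfin, hsurj, hdeg, hsup⟩ := hP
  exact ⟨isModuleGrading_shift hgr s, hproj, hfin, hsurj, fun i => hdeg (i + s), hsup⟩

end Shift

section Counting

variable (R : Type*) [Ring R] [IsSemisimpleRing R]

theorem isotypicComponent_mem_isotypicComponents (M : Type*) [AddCommGroup M] [Module R M]
    [IsSimpleModule R M] : isotypicComponent R R M ∈ isotypicComponents R R := by
  obtain ⟨I, ⟨e⟩⟩ := IsSemisimpleRing.exists_linearEquiv_ideal_of_isSimpleModule R M
  exact ⟨I, IsSimpleModule.congr e.symm, e.isotypicComponent_eq⟩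

theorem nonempty_equiv_of_isotypicComponent_eq {M N : Type*} [AddCommGroup M] [Module R M]
    [IsSimpleModule R M] [AddCommGroup N] [Module R N] [IsSimpleModule R N]
    (hMN : isotypicComponent R R M = isotypicComponent R R N) : Nonempty (M ≃ₗ[R] N) := by
  obtain ⟨I, ⟨e⟩⟩ := IsSemisimpleRing.exists_linearEquiv_ideal_of_isSimpleModule R M
  have := IsSimpleModule.congr e.symm
  have hle : I ≤ isotypicComponent R R N := by
    rw [← hMN, e.isotypicComponent_eq]
    exact Submodule.le_isotypicComponent I
  obtain ⟨e'⟩ := isIsotypicOfType_submodule_iff.1 (.isotypicComponent R R N) I hle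
  exact ⟨e ≪≫ₗ e'⟩

/-- A semisimple ring has finitely many simple modules, so that an injective relation from its
simple modules to themselves is surjective. -/
theorem exists_rel_of_injective (rel : Submodule R R → Submodule R R → Prop)
    (htotal : ∀ m, IsCoatom m → ∃ n, IsCoatom n ∧ rel m n)
    (hinj : ∀ m m' n n', IsCoatom m → IsCoatom m' → IsCoatom n → IsCoatom n' → rel m n →
      rel m' n' → Nonempty ((R ⧸ n) ≃ₗ[R] R ⧸ n') → Nonempty ((R ⧸ m) ≃ₗ[R] R ⧸ m'))
    (N : Type*) [AddCommGroup N] [Module R N] [IsSimpleModule R N] :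
    ∃ m n, IsCoatom m ∧ rel m n ∧ Nonempty (N ≃ₗ[R] R ⧸ n) := by
  have hex (c : isotypicComponents R R) :
      ∃ m : Submodule R R, IsCoatom m ∧ isotypicComponent R R (R ⧸ m) = c := by
    obtain ⟨_, S, hS, rfl⟩ := c
    obtain ⟨m, hm, ⟨e⟩⟩ := isSimpleModule_iff_quot_maximal.1 hS
    exact ⟨m, Ideal.isMaximal_def.1 hm, e.isotypicComponent_eq.symm⟩
  choose m hm hmc using hex
  choose n hn hrel using fun c => htotal (m c) (hm c)
  have hsimple (c) : IsSimpleModule R (R ⧸ n c) := isSimpleModule_iff_isCoatom.2 (hn c)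
  let H (c : isotypicComponents R R) : isotypicComponents R R :=
    ⟨isotypicComponent R R (R ⧸ n c), isotypicComponent_mem_isotypicComponents R (R ⧸ n c)⟩
  have hH : Function.Injective H := fun c c' hcc' => by
    obtain ⟨e⟩ := hinj _ _ _ _ (hm c) (hm c') (hn c) (hn c') (hrel c) (hrel c')
      (nonempty_equiv_of_isotypicComponent_eq R (congrArg Subtype.val hcc'))
    exact Subtype.ext ((hmc c).symm.trans (e.isotypicComponent_eq.trans (hmc c')))
  obtain ⟨c, hc⟩ := Finite.injective_iff_surjective.1 hH
    ⟨_, isotypicComponent_mem_isotypicComponents R N⟩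
  exact ⟨m c, n c, hm c, hrel c,
    nonempty_equiv_of_isotypicComponent_eq R (congrArg Subtype.val hc.symm)⟩

end Counting

section Surjectivity

variable {𝒜 : ℤ → Submodule K A} {Am T Ap : Subalgebra K A}

namespace TriangularDecomposition

variable (h : TriangularDecomposition K A 𝒜 Am T Ap)

theorem exists_isGradedProjectiveCover_isTop [FiniteDimensional K A] (hT : IsSemisimpleRing T)
    (hself : Module.Injective A A) (M : Type u) [AddCommGroup M] [Module T M]
    [IsSimpleModule T M] (e : ℤ) :
    ∃ (d : ℤ) (m : Submodule T T) (_ : IsCoatom m) (𝒮 : ℤ → Submodule K (A ⧸ h.inflate m))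
      (_ : IsLModule K A 𝒜 T d (T ⧸ m) (A ⧸ h.inflate m) 𝒮)
      (P : Type u) (_ : AddCommGroup P) (_ : Module A P) (_ : Module K P)
      (_ : IsScalarTower K A P) (𝒬 : ℤ → Submodule K P) (φ : P →ₗ[A] A ⧸ h.inflate m),
      IsGradedProjectiveCover K A 𝒜 (A ⧸ h.inflate m) 𝒮 P 𝒬 φ ∧ IsTop T 𝒬 M e := by
  let rel (m n : Submodule T T) : Prop :=
    ∃ (P : Type u) (_ : AddCommGroup P) (_ : Module A P) (_ : Module K P)
      (_ : IsScalarTower K A P) (𝒬 : ℤ → Submodule K P) (φ : P →ₗ[A] A ⧸ h.inflate m),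
      IsGradedProjectiveCover K A 𝒜 (A ⧸ h.inflate m) (quotGrading 𝒜 (h.inflate m)) P 𝒬 φ ∧
        ∃ e, IsTop T 𝒬 (T ⧸ n) e
  have htotal (m : Submodule T T) (hm : IsCoatom m) : ∃ n, IsCoatom n ∧ rel m n := by
    obtain ⟨P, _, _, _, _, 𝒬, φ, hP⟩ := h.exists_isGradedProjectiveCover hT hm
    have := isSimpleModule_iff_isCoatom.2 hm
    have := (h.isLModule_inflate hm).isSimpleModule h.internal
    obtain ⟨e, he, ht⟩ := hP.exists_isTop h hT hself
    obtain ⟨n, hn, ⟨ε⟩⟩ := isSimpleModule_iff_quot_maximal.1 he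
    exact ⟨n, Ideal.isMaximal_def.1 hn, P, _, _, _, _, 𝒬, φ, hP, e, ht.congr ε.symm⟩
  have hinj (m m' n n' : Submodule T T) (hm : IsCoatom m) (hm' : IsCoatom m') (hn : IsCoatom n)
      (_ : IsCoatom n') : rel m n → rel m' n' → Nonempty ((T ⧸ n) ≃ₗ[T] T ⧸ n') →
      Nonempty ((T ⧸ m) ≃ₗ[T] T ⧸ m') := by
    rintro ⟨P, _, _, _, _, 𝒬, φ, hP, e, ht⟩
      ⟨P', _, _, _, _, 𝒬', φ', hP', e', ht'⟩ ⟨ε⟩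
    have := isSimpleModule_iff_isCoatom.2 hm
    have := isSimpleModule_iff_isCoatom.2 hm'
    have := isSimpleModule_iff_isCoatom.2 hn
    have h1 := ht.shift e
    have h2 := (ht'.congr ε).shift e'
    rw [sub_self] at h1 h2
    exact ((hP.shift e).eq_of_isTop h hself (hP'.shift e') ((h.isLModule_inflate hm).shift e)
      ((h.isLModule_inflate hm').shift e') h1 h2).2
  obtain ⟨m, n, hm, ⟨P, _, _, _, _, 𝒬, φ, hP, e', ht⟩, ⟨ε⟩⟩ :=
    exists_rel_of_injective T rel htotal hinj M
  have hS := (h.isLModule_inflate hm).shift (e' - e)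
  refine ⟨_, m, hm, _, hS, P, _, _, _, _, _, φ, hP.shift (e' - e), ?_⟩
  have := (ht.congr ε).shift (e' - e)
  rwa [sub_sub_cancel] at this

end TriangularDecomposition

end Surjectivity

end

variable (K A : Type u) [Field K] [Ring A] [Algebra K A]

/-- Let `A` be self-injective with `T` semisimple.  For each simple
graded `T`-module `λ = (Ml, d)`, with simple graded module `S = L(λ)` and graded
projective cover `P = P(λ)` of `S`, the cover `P(λ)` is a highest weight object:
there is a (unique up to isomorphism) simple graded `T`-module `λ^h = (Mh, d')`
such that `[P(λ) : L(λ^h)] = 1` and every composition factor `L(μ)` of `P(λ)`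
satisfies `deg μ ≤ deg λ^h`, with equality only for `μ = λ^h`; moreover `Δ(λ^h)`
appears at the bottom of any standard filtration of `P(λ)`, and `λ ↦ λ^h` is a
permutation of the simple graded `T`-modules. -/
theorem projective_cover_highest_weight (𝒜 : ℤ → Submodule K A) (Am T Ap : Subalgebra K A)
    [FiniteDimensional K A] (h : TriangularDecomposition K A 𝒜 Am T Ap)
    (hT : IsSemisimpleRing ↥T) (hself : Module.Injective A A)
    (d : ℤ) (Ml : Type u) [AddCommGroup Ml] [Module ↥T Ml] [IsSimpleModule ↥T Ml]
    (S : Type u) [AddCommGroup S] [Module A S] [Module K S] [IsScalarTower K A S]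
    (𝒮 : ℤ → Submodule K S) (hS : IsLModule K A 𝒜 T d Ml S 𝒮)
    (P : Type u) [AddCommGroup P] [Module A P] [Module K P] [IsScalarTower K A P]
    (𝒬 : ℤ → Submodule K P) (φ : P →ₗ[A] S)
    (hP : IsGradedProjectiveCover K A 𝒜 S 𝒮 P 𝒬 φ) :
    -- (1) `P(λ)` is a highest weight object, with highest weight `λ^h = (Mh, d')`:
    (∃ (d' : ℤ) (Mh : Type u) (_ : AddCommGroup Mh) (_ : Module ↥T Mh),
      IsSimpleModule ↥T Mh ∧ IsHighestWeightOf K A 𝒜 T P 𝒬 Mh d') ∧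
    -- (2) `Δ(λ^h)` is at the bottom of any standard filtration of `P(λ)`:
    (∀ (d' : ℤ) (Mh : Type u) (_ : AddCommGroup Mh) (_ : Module ↥T Mh),
      IsSimpleModule ↥T Mh → IsHighestWeightOf K A 𝒜 T P 𝒬 Mh d' →
      ∀ (n : ℕ) (F : Fin (n + 1) → Submodule A P),
        IsStandardFiltration K A 𝒜 T Ap 𝒬 n F → ∀ hn : 0 < n,
        ∃ ι : Mh →+ (↥(F (⟨0, hn⟩ : Fin n).succ) ⧸
            Submodule.comap (F (⟨0, hn⟩ : Fin n).succ).subtype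
              (F (⟨0, hn⟩ : Fin n).castSucc)),
          IsProperStandardFor K A 𝒜 T Ap Mh _ ι ∧
          ∀ m : Mh, ι m ∈ factorPiece K A 𝒬
            (F (⟨0, hn⟩ : Fin n).castSucc) (F (⟨0, hn⟩ : Fin n).succ) d') ∧
    -- (3) `λ ↦ λ^h` is injective on isomorphism classes:
    (∀ (d₂ : ℤ) (Ml₂ : Type u) (_ : AddCommGroup Ml₂) (_ : Module ↥T Ml₂)
       (_ : IsSimpleModule ↥T Ml₂)
       (S₂ : Type u) (_ : AddCommGroup S₂) (_ : Module A S₂) (_ : Module K S₂)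
       (_ : IsScalarTower K A S₂) (𝒮₂ : ℤ → Submodule K S₂)
       (_ : IsLModule K A 𝒜 T d₂ Ml₂ S₂ 𝒮₂)
       (P₂ : Type u) (_ : AddCommGroup P₂) (_ : Module A P₂) (_ : Module K P₂)
       (_ : IsScalarTower K A P₂) (𝒬₂ : ℤ → Submodule K P₂) (φ₂ : P₂ →ₗ[A] S₂)
       (_ : IsGradedProjectiveCover K A 𝒜 S₂ 𝒮₂ P₂ 𝒬₂ φ₂)
       (d' : ℤ) (Mh : Type u) (_ : AddCommGroup Mh) (_ : Module ↥T Mh)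
       (_ : IsSimpleModule ↥T Mh),
       IsHighestWeightOf K A 𝒜 T P 𝒬 Mh d' →
       IsHighestWeightOf K A 𝒜 T P₂ 𝒬₂ Mh d' →
       (d = d₂ ∧ Nonempty (Ml ≃ₗ[↥T] Ml₂))) ∧
    -- (4) `λ ↦ λ^h` is surjective on isomorphism classes:
    (∀ (d' : ℤ) (Mh : Type u) (_ : AddCommGroup Mh) (_ : Module ↥T Mh),
      IsSimpleModule ↥T Mh →
      ∃ (d₂ : ℤ) (Ml₂ : Type u) (_ : AddCommGroup Ml₂) (_ : Module ↥T Ml₂)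
        (_ : IsSimpleModule ↥T Ml₂)
        (S₂ : Type u) (_ : AddCommGroup S₂) (_ : Module A S₂) (_ : Module K S₂)
        (_ : IsScalarTower K A S₂) (𝒮₂ : ℤ → Submodule K S₂)
        (_ : IsLModule K A 𝒜 T d₂ Ml₂ S₂ 𝒮₂)
        (P₂ : Type u) (_ : AddCommGroup P₂) (_ : Module A P₂) (_ : Module K P₂)
        (_ : IsScalarTower K A P₂) (𝒬₂ : ℤ → Submodule K P₂) (φ₂ : P₂ →ₗ[A] S₂),
        IsGradedProjectiveCover K A 𝒜 S₂ 𝒮₂ P₂ 𝒬₂ φ₂ ∧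
        IsHighestWeightOf K A 𝒜 T P₂ 𝒬₂ Mh d') := by
  have : IsNoetherianRing A := isNoetherian_of_tower K inferInstance
  have : IsArtinianRing A := isArtinian_of_tower K inferInstance
  have : Module.Finite A P := hP.2.2.1
  have : IsSimpleModule A S := hS.isSimpleModule h.internal
  refine ⟨?_, ?_, ?_, ?_⟩
  · obtain ⟨e, he, ht⟩ := hP.exists_isTop h hT hself
    exact ⟨e, _, _, _, he, ht.isHighestWeightOf⟩
  · intro d' Mh _ _ _ hw n F hF hn
    exact hP.exists_standard_bottom h hself (hw.isTop h hP.1) hF hn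
  · intro d₂ Ml₂ _ _ _ S₂ _ _ _ _ 𝒮₂ hS₂ P₂ _ _ _ _ 𝒬₂ φ₂ hP₂ d' Mh _ _ _ hw hw₂
    have : Module.Finite A P₂ := hP₂.2.2.1
    exact hP.eq_of_isTop h hself hP₂ hS hS₂ (hw.isTop h hP.1) (hw₂.isTop h hP₂.1)
  · intro d' Mh _ _ _
    obtain ⟨d₂, m, hm, 𝒮₂, hS₂, P₂, _, _, _, _, 𝒬₂, φ₂, hP₂, ht⟩ :=
      h.exists_isGradedProjectiveCover_isTop hT hself Mh d'
    exact ⟨d₂, T ⧸ m, _, _, isSimpleModule_iff_isCoatom.2 hm, A ⧸ h.inflate m, _, _, _,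
      inferInstance, 𝒮₂, hS₂, P₂, _, _, _, inferInstance, 𝒬₂, φ₂, hP₂, ht.isHighestWeightOf⟩

end TriangularPaper
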